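/- arXiv:1810.05335 — 4 statements merged into one kernel-verified Lean document; each statement's English description precedes it below -/
import Mathlib

section
/- Characterization of good ultrafilters: Suppose B is a complete Boolean algebra, λ is an infinite cardinal, and U is an ultrafilter on B. Then the following are equivalent: (A) U is λ⁺-good; (B) for every complete countable first-order theory T, U λ⁺-saturates T; (C) U λ⁺-saturates T_max, where T_max is the complete theory, in the language with a single binary relation symbol, of the structure whose universe is the set of finite subsets of ℕ and whose relation is interpreted as set inclusion. -/
open FirstOrder FirstOrder.Language Cardinal

namespace BVal

/-! ### Filters and ultrafilters on complete Boolean algebras -/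

variable {B : Type} [CompleteBooleanAlgebra B]

/-- A filter on a complete Boolean algebra. -/
def IsBFilter (D : Set B) : Prop :=
  ⊤ ∈ D ∧ ⊥ ∉ D ∧ (∀ a b : B, a ∈ D → a ≤ b → b ∈ D) ∧
    (∀ a b : B, a ∈ D → b ∈ D → a ⊓ b ∈ D)

/-- An ultrafilter on a complete Boolean algebra. -/
def IsBUltrafilter (U : Set B) : Prop :=
  IsBFilter U ∧ ∀ a : B, a ∈ U ∨ aᶜ ∈ U

/-- An antichain in a complete Boolean algebra: pairwise disjoint nonzero elements. -/
def IsBAntichain (S : Set B) : Prop :=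
  (∀ a ∈ S, a ≠ ⊥) ∧ S.Pairwise fun a b => a ⊓ b = ⊥

/-- `ccOf B` is the least cardinal `κ` such that every antichain of `B` has cardinality `< κ`. -/
noncomputable def ccOf (B : Type) [CompleteBooleanAlgebra B] : Cardinal :=
  sInf {κ : Cardinal | ∀ S : Set B, IsBAntichain S → Cardinal.mk S < κ}

/-! ### Regularity -/

/-- An `I`-quasiregular family: finite meets are nonzero, countably infinite meets are zero. -/
def IsQuasiregularFamily {I : Type} (a : I → B) : Prop :=
  (∀ s : Finset I, s.inf a ≠ ⊥) ∧
    ∀ J : Set I, J.Countable → J.Infinite → (⨅ i ∈ J, a i) = ⊥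

/-- An `I`-regular family: quasiregular, and the set of nonzero elements deciding
every member of the family is dense. -/
def IsRegularFamily {I : Type} (a : I → B) : Prop :=
  IsQuasiregularFamily a ∧
    ∀ b : B, b ≠ ⊥ → ∃ b' : B, b' ≠ ⊥ ∧ b' ≤ b ∧ ∀ i, b' ≤ a i ∨ b' ≤ (a i)ᶜ

/-- A filter `D` is `lam`-regular if it contains some `lam`-regular family. -/
def IsRegularFilter (D : Set B) (lam : Cardinal) : Prop :=
  ∃ a : Quotient.out lam → B, IsRegularFamily a ∧ ∀ α, a α ∈ D

/-! ### Boolean-valued structures -/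

/-- Plug the tuple `b` into the `Fin`-indexed free variables of the bounded formula `φ`,
relabelling the parameters along `e`. -/
def plugEmb {L : FirstOrder.Language.{0, 0}} {C D : Type} {k : ℕ} (φ : L.BoundedFormula C k)
    (e : C → D) (b : Fin k → D) : L.Formula D :=
  φ.toFormula.relabel (Sum.elim e b)

/-- Plug the tuple `b` into the `Fin`-indexed free variables of the bounded formula `φ`. -/
def plug {L : FirstOrder.Language.{0, 0}} {C : Type} {k : ℕ} (φ : L.BoundedFormula C k)
    (b : Fin k → C) : L.Formula C :=
  plugEmb φ id b

/-- The finite conjunction of a list of bounded formulas. -/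
def listConj {L : FirstOrder.Language.{0, 0}} {α : Type} {n : ℕ} :
    List (L.BoundedFormula α n) → L.BoundedFormula α n
  | [] => ⊤
  | φ :: l => φ ⊓ listConj l

/-- The axioms for a `B`-valued `L`-structure with carrier `C` and evaluation map `val`,
where formulas with parameters from `C` are encoded as `L.Formula C` (the parameters being
the free variables): logically valid formulas get value `⊤`, negation and conjunction are
respected, the value of an existential formula is the supremum of the values of its instances,
and distinct elements are not identified. -/
def IsBVal {L : FirstOrder.Language.{0, 0}} {C : Type} (val : L.Formula C → B) : Prop :=
  (∀ φ : L.Formula C,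
      (∀ (N : Type) [L.Structure N] [Nonempty N] (v : C → N), φ.Realize v) → val φ = ⊤) ∧
  (∀ φ : L.Formula C, val φ.not = (val φ)ᶜ) ∧
  (∀ φ ψ : L.Formula C, val (φ ⊓ ψ) = val φ ⊓ val ψ) ∧
  (∀ φ : L.BoundedFormula C 1, val φ.ex = ⨆ a : C, val (plug φ fun _ => a)) ∧
  (∀ a b : C, a ≠ b → val (Term.equal (Term.var a) (Term.var b)) < ⊤)

/-- Fullness of a `B`-valued structure: every existential value is attained. -/
def IsFull {L : FirstOrder.Language.{0, 0}} {C : Type} (val : L.Formula C → B) : Prop :=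
  ∀ φ : L.BoundedFormula C 1, ∃ a : C, val φ.ex = val (plug φ fun _ => a)

/-- The `B`-valued structure gives every sentence of `T` the value `⊤`. -/
def BModels {L : FirstOrder.Language.{0, 0}} {C : Type} (val : L.Formula C → B) (T : L.Theory) : Prop :=
  ∀ φ ∈ T, val (Formula.relabel (fun e : Empty => e.elim) φ) = ⊤

/-- `val` is a full `B`-valued model of `T`. -/
def IsFullBModel {L : FirstOrder.Language.{0, 0}} (T : L.Theory) {C : Type}
    (val : L.Formula C → B) : Prop :=
  IsBVal val ∧ IsFull val ∧ BModels val T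

/-- An elementary map between `B`-valued structures. -/
def ElemMap {L : FirstOrder.Language.{0, 0}} {C D : Type} (v : L.Formula C → B) (w : L.Formula D → B)
    (f : C → D) : Prop :=
  ∀ φ : L.Formula C, v φ = w (φ.relabel f)

/-- `lam⁺`-saturation for full `B`-valued models of `T`: elementary maps from models of
cardinality at most `lam` extend along elementary extensions. -/
def BSaturated {L : FirstOrder.Language.{0, 0}} (T : L.Theory) (lam : Cardinal) {C : Type}
    (val : L.Formula C → B) : Prop :=
  ∀ (C0 C1 : Type) (v0 : L.Formula C0 → B) (v1 : L.Formula C1 → B),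
    IsFullBModel T v0 → IsFullBModel T v1 → Cardinal.mk C1 ≤ lam →
    ∀ ι : C0 → C1, ElemMap v0 v1 ι →
    ∀ f : C0 → C, ElemMap v0 val f →
    ∃ g : C1 → C, ElemMap v1 val g ∧ g ∘ ι = f

/-- `lam⁺`-universality for full `B`-valued models of `T`. -/
def BUniversal {L : FirstOrder.Language.{0, 0}} (T : L.Theory) (lam : Cardinal) {C : Type}
    (val : L.Formula C → B) : Prop :=
  ∀ (C1 : Type) (v1 : L.Formula C1 → B), IsFullBModel T v1 → Cardinal.mk C1 ≤ lam →
    ∃ f : C1 → C, ElemMap v1 val f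

/-! ### Ordinary structures, specializations, ordinary saturation -/

/-- A bundled (nonempty) ordinary `L`-structure. -/
structure OrdStructure (L : FirstOrder.Language.{0, 0}) : Type 1 where
  carrier : Type
  [str : L.Structure carrier]
  [nonempty' : Nonempty carrier]

attribute [instance] OrdStructure.str OrdStructure.nonempty'

instance {L : FirstOrder.Language.{0, 0}} : CoeSort (OrdStructure L) Type :=
  ⟨OrdStructure.carrier⟩

/-- `(N, π)` is a specialization of the `B`-valued structure `val` at the ultrafilter `U`:
`π` is surjective and a formula holds in `N` of the images iff its value lies in `U`. -/
def IsSpecialization {L : FirstOrder.Language.{0, 0}} {C : Type} (val : L.Formula C → B) (U : Set B)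
    (N : Type) [L.Structure N] (π : C → N) : Prop :=
  Function.Surjective π ∧ ∀ φ : L.Formula C, (val φ ∈ U ↔ φ.Realize π)

/-- An ordinary structure `N` is `lam⁺`-saturated: every finitely satisfiable set of formulas
in one free variable with parameters from a subset of `N` of cardinality at most `lam`
is realized in `N`. -/
def OrdSaturated (L : FirstOrder.Language.{0, 0}) (lam : Cardinal) (N : Type) [L.Structure N] : Prop :=
  ∀ A : Set N, Cardinal.mk A ≤ lam →
    ∀ p : Set (L.BoundedFormula A 1),
      (∀ s : Finset (L.BoundedFormula A 1), ↑s ⊆ p →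
        ∃ b : N, ∀ φ ∈ s, BoundedFormula.Realize φ Subtype.val fun _ => b) →
      ∃ b : N, ∀ φ ∈ p, BoundedFormula.Realize φ Subtype.val fun _ => b

/-- The ultrafilter `U` on `B` `lam⁺`-saturates the theory `T`: for every `lam⁺`-saturated
full `B`-valued model of `T`, every specialization at `U` is `lam⁺`-saturated. -/
def Saturates {L : FirstOrder.Language.{0, 0}} (U : Set B) (T : L.Theory) (lam : Cardinal) : Prop :=
  ∀ (C : Type) (val : L.Formula C → B), IsFullBModel T val → BSaturated T lam val →
    ∀ (N : Type) [L.Structure N] (π : C → N), IsSpecialization val U N π →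
      OrdSaturated L lam N

/-! ### Distributions -/

/-- An `I`-distribution in `B`. -/
def IsDistribution {I : Type} (A : Finset I → B) : Prop :=
  A ∅ = ⊤ ∧ (∀ s, A s ≠ ⊥) ∧ ∀ s t : Finset I, s ⊆ t → A t ≤ A s

/-- A multiplicative distribution. -/
def MultiplicativeDist {I : Type} (A : Finset I → B) : Prop :=
  ∀ s : Finset I, A s = s.inf fun i => A {i}

/-- `A'` refines `A`. -/
def Refines {I : Type} (A' A : Finset I → B) : Prop :=
  ∀ s, A' s ≤ A s

/-- `A'` conservatively refines `A`. -/
def ConsRefines {I : Type} (A' A : Finset I → B) : Prop :=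
  ∀ s : Finset I, A' s = A s ⊓ s.inf fun i => A' {i}

/-- The distribution `A` lies in the filter `D`. -/
def InFilter {I : Type} (A : Finset I → B) (D : Set B) : Prop :=
  ∀ s, A s ∈ D

/-- `A` has a multiplicative refinement in `D`. -/
def HasMultRefinement {I : Type} (A : Finset I → B) (D : Set B) : Prop :=
  ∃ A' : Finset I → B, IsDistribution A' ∧ MultiplicativeDist A' ∧ InFilter A' D ∧ Refines A' A

/-- A filter `D` is `lam⁺`-good if every `lam`-distribution in `D` has a multiplicative
refinement in `D`. -/
def IsGoodFilter (D : Set B) (lam : Cardinal) : Prop :=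
  ∀ A : Finset (Quotient.out lam) → B, IsDistribution A → InFilter A D →
    HasMultRefinement A D

/-- A distribution is regular if the family of its values at singletons is regular. -/
def IsRegularDistribution {I : Type} (A : Finset I → B) : Prop :=
  IsRegularFamily fun i => A {i}

/-! ### Łoś maps and possibilities -/

/-- An `I`-sequence of formulas `φ_i(x̄, ȳ_i)`: `x̄` has length `n`, `ȳ_i` has length `m i`. -/
structure FormulaSeq (L : FirstOrder.Language.{0, 0}) (I : Type) : Type 1 where
  n : ℕ
  m : I → ℕ
  φ : ∀ i, L.Formula (Fin n ⊕ Fin (m i))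

/-- The formula `∃ x̄, ⋀_{i ∈ s} φ_i(x̄, ā_i)`, with parameters `a`. -/
noncomputable def losFormula {L : FirstOrder.Language.{0, 0}} {C I : Type} (Φ : FormulaSeq L I)
    (a : ∀ i, Fin (Φ.m i) → C) (s : Finset I) : L.Formula C :=
  BoundedFormula.exs (listConj (s.toList.map fun i =>
    BoundedFormula.relabel
      (fun v : Fin Φ.n ⊕ Fin (Φ.m i) =>
        Sum.elim (fun k => Sum.inr k) (fun j => Sum.inl (a i j)) v)
      (Φ.φ i)))

/-- `A` is a `(I, T, Φ)`-Łoś map. -/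
def IsLosMapFor {L : FirstOrder.Language.{0, 0}} (T : L.Theory) {I : Type} (A : Finset I → B)
    (Φ : FormulaSeq L I) : Prop :=
  ∃ (C : Type) (val : L.Formula C → B), IsFullBModel T val ∧
    ∃ a : ∀ i, Fin (Φ.m i) → C, ∀ s : Finset I, A s = val (losFormula Φ a s)

/-- `A` is a `(I, T)`-Łoś map. -/
def IsLosMap {L : FirstOrder.Language.{0, 0}} (T : L.Theory) {I : Type} (A : Finset I → B) : Prop :=
  ∃ Φ : FormulaSeq L I, IsLosMapFor T A Φ

/-- `A` is a `(I, T)`-Łoś map witnessed by a formula sequence whose `x̄` has length `k`. -/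
def IsLosMapOfArity {L : FirstOrder.Language.{0, 0}} (T : L.Theory) {I : Type} (A : Finset I → B)
    (k : ℕ) : Prop :=
  ∃ Φ : FormulaSeq L I, Φ.n = k ∧ IsLosMapFor T A Φ

/-- `A` is a `(I, T)`-possibility: it conservatively refines some `(I, T)`-Łoś map. -/
def IsPossibility {L : FirstOrder.Language.{0, 0}} (T : L.Theory) {I : Type} (A : Finset I → B) : Prop :=
  ∃ A0 : Finset I → B, IsDistribution A0 ∧ IsLosMap T A0 ∧ ConsRefines A A0

/-! ### Partial types -/

/-- `p` is a partial type over the `B`-valued structure `val`: each finite conjunction has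
nonzero existential value. -/
def IsPartialType {L : FirstOrder.Language.{0, 0}} {C : Type} (val : L.Formula C → B) {k : ℕ}
    (p : Set (L.BoundedFormula C k)) : Prop :=
  ∀ Γ : Finset (L.BoundedFormula C k), ↑Γ ⊆ p →
    val (BoundedFormula.exs (listConj Γ.toList)) ≠ ⊥

/-- `p` is a partial `U`-type over `val`: each finite conjunction has existential value in `U`. -/
def IsUType {L : FirstOrder.Language.{0, 0}} {C : Type} (val : L.Formula C → B) (U : Set B) {k : ℕ}
    (p : Set (L.BoundedFormula C k)) : Prop :=
  ∀ Γ : Finset (L.BoundedFormula C k), ↑Γ ⊆ p →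
    val (BoundedFormula.exs (listConj Γ.toList)) ∈ U

/-- The Łoś map of the partial type `p`, as a `p`-distribution. -/
noncomputable def losOfType {L : FirstOrder.Language.{0, 0}} {C : Type} (val : L.Formula C → B) {k : ℕ}
    (p : Set (L.BoundedFormula C k)) : Finset ↥p → B := fun Γ =>
  val (BoundedFormula.exs (listConj (Γ.toList.map Subtype.val)))

/-! ### Boolean ultrapowers -/

/-- The carrier of the Boolean ultrapower `M^B`: maximal antichains indexed by `M`. -/
def BUP (B : Type) [CompleteBooleanAlgebra B] (M : Type) : Type :=
  {a : M → B // (∀ m m' : M, m ≠ m' → a m ⊓ a m' = ⊥) ∧ (⨆ m, a m) = ⊤}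

/-- The evaluation map of the Boolean ultrapower `M^B`. -/
noncomputable def bupVal (B : Type) [CompleteBooleanAlgebra B] {L : FirstOrder.Language.{0, 0}}
    (M : Type) [L.Structure M] : L.Formula (BUP B M) → B := fun φ =>
  letI : DecidableEq (BUP B M) := Classical.decEq _
  ⨆ (w : BUP B M → M) (_ : φ.Realize w), φ.freeVarFinset.inf fun c => c.1 (w c)

/-- A bundled complete Boolean algebra. -/
structure CBA : Type 1 where
  carrier : Type
  [str : CompleteBooleanAlgebra carrier]

attribute [instance] CBA.str

instance : CoeSort CBA Type := ⟨CBA.carrier⟩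

end BVal

open BVal

/-- The structure of finite subsets of `ℕ` under inclusion, in the language with a
single binary relation symbol. -/
instance : FirstOrder.Language.order.Structure (Finset ℕ) :=
  FirstOrder.Language.orderStructure (Finset ℕ)

namespace GU
variable {B : Type} [CompleteBooleanAlgebra B]

/-- Boolean homomorphisms out of a power set, subject to lower bounds. -/
theorem sikorski {X : Type*} (R : Set (Set X × B)) (h1 : (Set.univ, ⊤) ∈ R)
    (h2 : ∀ p ∈ R, ∀ q ∈ R, (p.1 ∩ q.1, p.2 ⊓ q.2) ∈ R)
    (h3 : ∀ p ∈ R, p.1 = ∅ → p.2 = ⊥) :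
    ∃ h : Set X → B, (∀ S, h Sᶜ = (h S)ᶜ) ∧ (∀ S T, h (S ∩ T) = h S ⊓ h T) ∧
      ∀ p ∈ R, p.2 ≤ h p.1 := by
  classical
  let G : Set (Set (Set X × B)) := {R | (Set.univ, ⊤) ∈ R ∧
    (∀ p ∈ R, ∀ q ∈ R, (p.1 ∩ q.1, p.2 ⊓ q.2) ∈ R) ∧ (∀ p ∈ R, p.1 = ∅ → p.2 = ⊥)}
  obtain ⟨M, hRM, hM⟩ := zorn_subset_nonempty G (by
    intro c hc hch hne
    refine ⟨⋃₀ c, ⟨?_, ?_, ?_⟩, fun s hs => Set.subset_sUnion_of_mem hs⟩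
    · obtain ⟨s, hs⟩ := hne
      exact ⟨s, hs, (hc hs).1⟩
    · rintro p ⟨s, hs, hp⟩ q ⟨t, ht, hq⟩
      rcases hch.total hs ht with h | h
      · exact ⟨t, ht, (hc ht).2.1 _ (h hp) _ hq⟩
      · exact ⟨s, hs, (hc hs).2.1 _ hp _ (h hq)⟩
    · rintro p ⟨s, hs, hp⟩
      exact (hc hs).2.2 p hp) R ⟨h1, h2, h3⟩
  obtain ⟨m1, m2, m3⟩ := hM.prop
  -- anything compatible is in M
  have key : ∀ (z : Set X) (d : B), (∀ p ∈ M, p.1 ∩ z = ∅ → p.2 ⊓ d = ⊥) → (z, d) ∈ M := by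
    intro z d hz
    let M' : Set (Set X × B) := M ∪ {q | ∃ p ∈ M, q = (p.1 ∩ z, p.2 ⊓ d)}
    have hM' : M' ∈ G := by
      refine ⟨Or.inl m1, ?_, ?_⟩
      · rintro p (hp | ⟨p, hp, rfl⟩) q (hq | ⟨q, hq, rfl⟩)
        · exact Or.inl (m2 _ hp _ hq)
        · refine Or.inr ⟨_, m2 _ hp _ hq, ?_⟩
          simp [Set.inter_assoc, inf_assoc]
        · refine Or.inr ⟨_, m2 _ hp _ hq, ?_⟩
          simp only [Prod.mk.injEq]
          exact ⟨Set.inter_right_comm _ _ _, inf_right_comm _ _ _⟩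
        · refine Or.inr ⟨_, m2 _ hp _ hq, ?_⟩
          simp only [Prod.mk.injEq]
          constructor
          · ext x; simp; tauto
          · rw [inf_inf_inf_comm, inf_idem]
      · rintro p (hp | ⟨p, hp, rfl⟩) h
        · exact m3 _ hp h
        · exact hz p hp h
    have : M' ⊆ M := hM.le_of_ge hM' Set.subset_union_left
    exact this (Or.inr ⟨_, m1, by simp⟩)
  let h : Set X → B := fun S => sSup {b | (S, b) ∈ M}
  have hmem : ∀ S, (S, h S) ∈ M := by
    intro S
    apply key
    intro p hp hps
    simp only [h, inf_sSup_eq, iSup_eq_bot]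
    intro b hb
    exact m3 _ (m2 _ hp _ hb) hps
  have hle : ∀ S b, (S, b) ∈ M → b ≤ h S := fun S b hb => le_sSup hb
  have hmono : ∀ S T, S ⊆ T → h S ≤ h T := by
    intro S T hST
    apply hle
    apply key
    intro p hp hpT
    refine m3 _ (m2 _ hp _ (hmem S)) ?_
    exact Set.subset_empty_iff.1 (hpT ▸ Set.inter_subset_inter_right _ hST)
  refine ⟨h, ?_, ?_, fun p hp => hle _ _ (hRM hp)⟩
  · intro S
    apply le_antisymm
    · rw [le_compl_iff_disjoint_right, disjoint_iff]
      exact m3 _ (m2 _ (hmem _) _ (hmem _)) (Set.compl_inter_self S)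
    · apply hle
      apply key
      intro p hp hpS
      rw [← disjoint_iff, disjoint_compl_right_iff]
      refine le_trans (hle p.1 p.2 hp) (hmono _ _ ?_)
      intro x hx
      by_contra hxS
      exact (Set.eq_empty_iff_forall_notMem.1 hpS x) ⟨hx, hxS⟩
  · intro S T
    apply le_antisymm
    · exact le_inf (hmono _ _ Set.inter_subset_left) (hmono _ _ Set.inter_subset_right)
    · exact hle _ _ (m2 _ (hmem S) _ (hmem T))

variable {L : FirstOrder.Language.{0, 0}}

/-- Boolean-valued pre-models: homomorphisms on formulas sending valid formulas to `⊤`. -/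
def IsPre {C : Type} (v : L.Formula C → B) : Prop :=
  (∀ φ : L.Formula C,
      (∀ (N : Type) [L.Structure N] [Nonempty N] (u : C → N), φ.Realize u) → v φ = ⊤) ∧
  (∀ φ : L.Formula C, v φ.not = (v φ)ᶜ) ∧
  (∀ φ ψ : L.Formula C, v (φ ⊓ ψ) = v φ ⊓ v ψ)

theorem IsPre.of_bval {C : Type} {v : L.Formula C → B} (h : IsBVal v) : IsPre v :=
  ⟨h.1, h.2.1, h.2.2.1⟩

theorem IsPre.bot {C : Type} {v : L.Formula C → B} (h : IsPre v) {φ : L.Formula C}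
    (hφ : ∀ (N : Type) [L.Structure N] [Nonempty N] (u : C → N), ¬ φ.Realize u) : v φ = ⊥ := by
  have := h.1 φ.not (fun N _ _ u => by simpa using hφ N u)
  rw [h.2.1] at this
  exact compl_eq_top.1 this

theorem IsPre.mono {C : Type} {v : L.Formula C → B} (h : IsPre v) {φ ψ : L.Formula C}
    (hφ : ∀ (N : Type) [L.Structure N] [Nonempty N] (u : C → N), φ.Realize u → ψ.Realize u) :
    v φ ≤ v ψ := by
  have := h.bot (φ := φ ⊓ ψ.not) (fun N _ _ u => by
    have := hφ N u
    simp only [Formula.Realize, BoundedFormula.realize_inf, Formula.not,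
      BoundedFormula.realize_not] at this ⊢
    tauto)
  rw [h.2.2, h.2.1] at this
  rwa [← disjoint_iff, disjoint_compl_right_iff] at this

theorem IsPre.congr {C : Type} {v : L.Formula C → B} (h : IsPre v) {φ ψ : L.Formula C}
    (hφ : ∀ (N : Type) [L.Structure N] [Nonempty N] (u : C → N), φ.Realize u ↔ ψ.Realize u) :
    v φ = v ψ :=
  le_antisymm (h.mono fun N _ _ u => (hφ N u).1) (h.mono fun N _ _ u => (hφ N u).2)

theorem IsPre.inf_bot {C : Type} {v : L.Formula C → B} (h : IsPre v) {φ ψ : L.Formula C}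
    (hφ : ∀ (N : Type) [L.Structure N] [Nonempty N] (u : C → N), φ.Realize u → ψ.Realize u → False) :
    v φ ⊓ v ψ = ⊥ := by
  rw [← h.2.2]
  apply h.bot
  intro N _ _ u hu
  simp only [Formula.Realize, BoundedFormula.realize_inf] at hu
  exact hφ N u hu.1 hu.2

theorem IsPre.pull {C D : Type} {v : L.Formula D → B} (h : IsPre v) (e : C → D) :
    IsPre (fun φ : L.Formula C => v (φ.relabel e)) := by
  refine ⟨?_, ?_, ?_⟩
  · intro φ hφ
    apply h.1
    intro N _ _ u
    rw [Formula.realize_relabel]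
    exact hφ N _
  · intro φ
    show v _ = _
    rw [← h.2.1]
    apply h.congr
    intro N _ _ u
    simp
  · intro φ ψ
    show v _ = _
    rw [← h.2.2]
    apply h.congr
    intro N _ _ u
    rw [Formula.realize_relabel]
    simp only [Formula.realize_inf, Formula.realize_relabel]

theorem IsPre.relabel_relabel {C D E : Type} {v : L.Formula E → B} (h : IsPre v) (e : C → D)
    (f : D → E) (φ : L.Formula C) : v ((φ.relabel e).relabel f) = v (φ.relabel (f ∘ e)) := by
  apply h.congr
  intro N _ _ u
  simp only [Formula.realize_relabel, Function.comp_assoc]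

theorem IsPre.relabel_id {C : Type} {v : L.Formula C → B} (h : IsPre v) 
    (φ : L.Formula C) : v (φ.relabel id) = v φ := by
  apply h.congr
  intro N _ _ u
  simp only [Formula.realize_relabel, Function.comp_id]

/-- If one premodel dominates the other along a map, they agree. -/
theorem IsPre.eq_of_le {C D : Type} {v : L.Formula C → B} {w : L.Formula D → B} (hv : IsPre v)
    (hw : IsPre w) (e : C → D) (h : ∀ φ, v φ ≤ w (φ.relabel e)) (φ : L.Formula C) :
    w (φ.relabel e) = v φ := by
  refine le_antisymm ?_ (h φ)
  have := h φ.not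
  have h' : w (φ.not.relabel e) = (w (φ.relabel e))ᶜ := (hw.pull e).2.1 φ
  rw [hv.2.1, h'] at this
  exact compl_le_compl_iff_le.1 this

/-- Existence of premodels with prescribed lower bounds. -/
theorem ext_lemma {X : Type*} {C : Type} (N : X → Type) [∀ x, L.Structure (N x)]
    [∀ x, Nonempty (N x)] (u : ∀ x, C → N x)
    (R : Set (Set X × B)) (h1 : (Set.univ, ⊤) ∈ R)
    (h2 : ∀ p ∈ R, ∀ q ∈ R, (p.1 ∩ q.1, p.2 ⊓ q.2) ∈ R)
    (h3 : ∀ p ∈ R, p.1 = ∅ → p.2 = ⊥) :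
    ∃ v : L.Formula C → B, IsPre v ∧ ∀ p ∈ R, ∀ φ : L.Formula C,
      (∀ x ∈ p.1, φ.Realize (u x)) → p.2 ≤ v φ := by
  obtain ⟨h, hc, hi, hR⟩ := sikorski R h1 h2 h3
  have hmono : ∀ S T, S ⊆ T → h S ≤ h T := by
    intro S T hST
    have := hi S T
    rw [Set.inter_eq_left.2 hST] at this
    rw [this]; exact inf_le_right
  refine ⟨fun φ => h {x | φ.Realize (u x)}, ⟨?_, ?_, ?_⟩, ?_⟩
  · intro φ hφ
    have : {x | φ.Realize (u x)} = Set.univ := Set.eq_univ_of_forall fun x => hφ _ _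
    show h _ = ⊤
    rw [this]
    exact top_le_iff.1 (hR _ h1)
  · intro φ
    show h _ = _
    rw [← hc]
    congr 1
  · intro φ ψ
    show h _ = _
    rw [← hi]
    congr 1
    ext x
    simp [Formula.Realize]
  · intro p hp φ hφ
    exact (hR p hp).trans (hmono _ _ hφ)

/-- Finite support of formulas. -/
theorem fin_lemma {C : Type} {k : ℕ} (φ : L.BoundedFormula C k) :
    ∃ (n : ℕ) (φ' : L.BoundedFormula (Fin n) k) (c : Fin n → C),
      ∀ (N : Type) [L.Structure N] (u : C → N) (xs : Fin k → N),
        φ'.Realize (u ∘ c) xs ↔ φ.Realize u xs := by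
  classical
  let e := φ.freeVarFinset.equivFin
  refine ⟨φ.freeVarFinset.card, φ.restrictFreeVar e, fun i => (e.symm i : C), ?_⟩
  intro N _ u xs
  apply BoundedFormula.realize_restrictFreeVar
  simp

/-- Quantifying out arbitrarily many variables. -/
theorem exi_lemma {α β : Type} (θ : L.Formula (α ⊕ β)) :
    ∃ χ : L.Formula α, ∀ (N : Type) [L.Structure N] [Nonempty N] (u : α → N),
      χ.Realize u ↔ ∃ z : β → N, θ.Realize (Sum.elim u z) := by
  classical
  let F := BoundedFormula.freeVarFinset θ
  let f : F → α ⊕ F := fun x => Sum.elim (fun a => Sum.inl a) (fun _ => Sum.inr x) x.1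
  have key : ∀ (N : Type) [L.Structure N] (u : α → N) (z : F → N) (z' : β → N),
      (∀ b (h : Sum.inr b ∈ F), z ⟨_, h⟩ = z' b) →
      (Formula.Realize (BoundedFormula.restrictFreeVar θ f) (Sum.elim u z) ↔
        θ.Realize (Sum.elim u z')) := by
    intro N _ u z z' hz
    apply BoundedFormula.realize_restrictFreeVar
    rintro ⟨a | b, h⟩
    · simp [f]
    · simpa [f] using hz b h
  refine ⟨Formula.iExs F (BoundedFormula.restrictFreeVar θ f), ?_⟩
  intro N _ _ u
  rw [Formula.realize_iExs]
  constructor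
  · rintro ⟨z, hz⟩
    refine ⟨fun b => if h : Sum.inr b ∈ F then z ⟨_, h⟩ else Classical.arbitrary N, ?_⟩
    refine (key N u z _ ?_).1 hz
    intro b h
    simp [h]
  · rintro ⟨z, hz⟩
    refine ⟨fun x => Sum.elim u z x.1, ?_⟩
    refine (key N u _ z ?_).2 hz
    intro b h
    simp

theorem realize_listConj {α : Type} {n : ℕ} {N : Type} [L.Structure N]
    (l : List (L.BoundedFormula α n)) (u : α → N) (xs : Fin n → N) :
    (listConj l).Realize u xs ↔ ∀ φ ∈ l, φ.Realize u xs := by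
  induction l with
  | nil => simp [listConj]
  | cons a l ih => simp [listConj, ih]

theorem IsPre.le_listConj {C : Type} {v : L.Formula C → B} (h : IsPre v) (b : B)
    (l : List (L.Formula C)) (hl : ∀ φ ∈ l, b ≤ v φ) : b ≤ v (listConj l) := by
  induction l with
  | nil =>
    have : v (listConj []) = ⊤ := h.1 _ (fun N _ _ u => by
      simp [listConj, Formula.Realize])
    rw [this]; exact le_top
  | cons a l ih =>
    have : v (listConj (a :: l)) = v a ⊓ v (listConj l) := h.2.2 _ _
    rw [this]
    exact le_inf (hl _ (by simp)) (ih fun φ hφ => hl φ (by simp [hφ]))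

/-- Premodels respect value-one equality. -/
theorem IsPre.relabel_congr {C D : Type} {v : L.Formula D → B} (h : IsPre v) (f g : C → D)
    (hfg : ∀ c, v (Term.equal (Term.var (f c)) (Term.var (g c))) = ⊤) (φ : L.Formula C) :
    v (φ.relabel f) = v (φ.relabel g) := by
  have main : ∀ f g : C → D, (∀ c, v (Term.equal (Term.var (f c)) (Term.var (g c))) = ⊤) →
      v (φ.relabel f) ≤ v (φ.relabel g) := by
    intro f g hfg
    obtain ⟨n, φ', c, hc⟩ := fin_lemma φ
    let l : List (L.Formula D) := (List.finRange n).map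
      fun i => Term.equal (Term.var (f (c i))) (Term.var (g (c i)))
    have h1 : v (listConj l) = ⊤ := by
      apply top_le_iff.1
      apply h.le_listConj
      intro φ hφ
      obtain ⟨i, -, rfl⟩ := List.mem_map.1 hφ
      exact (hfg _).ge
    have h2 : v (φ.relabel f) = v (φ.relabel f ⊓ listConj l) := by
      rw [h.2.2, h1, inf_top_eq]
    rw [h2]
    apply h.mono
    intro N _ _ u hu
    rw [Formula.realize_inf, Formula.realize_relabel] at hu
    obtain ⟨hu1, hu2⟩ := hu
    rw [Formula.Realize, realize_listConj] at hu2
    rw [Formula.realize_relabel, Formula.Realize, ← hc]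
    rw [Formula.Realize, ← hc] at hu1
    convert hu1 using 1
    funext i
    have := hu2 _ (List.mem_map.2 ⟨i, List.mem_finRange i, rfl⟩)
    have := (Formula.realize_equal (x := u)).1 this
    simpa using this.symm
  refine le_antisymm (main f g hfg) (main g f fun c => ?_)
  rw [← hfg c]
  apply h.congr
  intro N _ _ u
  simp only [Formula.realize_equal, Term.realize_var]
  exact eq_comm

theorem realize_plug {C : Type} {k : ℕ} (φ : L.BoundedFormula C k) (b : Fin k → C)
    {N : Type} [L.Structure N] (u : C → N) :
    (plug φ b).Realize u ↔ φ.Realize u (u ∘ b) := by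
  rw [plug, plugEmb, Formula.realize_relabel, BoundedFormula.realize_toFormula]
  rfl

theorem realize_ex1 {C : Type} (φ : L.BoundedFormula C 1) 
    {N : Type} [L.Structure N] (u : C → N) :
    Formula.Realize φ.ex u ↔ ∃ a, φ.Realize u (fun _ => a) := by
  rw [Formula.Realize, BoundedFormula.realize_ex]
  have : ∀ a : N, (Fin.snoc default a : Fin 1 → N) = fun _ => a := by
    intro a; funext i; fin_cases i; rfl
  simp [this]

end GU

namespace GU
variable {B : Type} [CompleteBooleanAlgebra B] {L : FirstOrder.Language.{0, 0}}

/-- The language of witness functions for `L`. -/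
def SkL (L : FirstOrder.Language.{0, 0}) : FirstOrder.Language.{0, 0} :=
  ⟨fun n => L.BoundedFormula (Fin n) 1, fun _ => Empty⟩

theorem mk_bounded_le {G : Type} {lam : Cardinal.{0}} (hlam : ℵ₀ ≤ lam) (hL : L.card ≤ ℵ₀)
    (hG : Cardinal.mk G ≤ lam) (n : ℕ) : Cardinal.mk (L.BoundedFormula G n) ≤ lam := by
  have h1 : Cardinal.mk (L.BoundedFormula G n) ≤ Cardinal.mk (Σ n, L.BoundedFormula G n) :=
    Cardinal.mk_le_of_injective (f := fun φ => ⟨n, φ⟩) (fun a b h => by simpa using h)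
  refine h1.trans (BoundedFormula.card_le.trans ?_)
  simp only [Cardinal.lift_id]
  refine max_le hlam (Cardinal.add_le_of_le hlam ?_ ?_)
  · simpa using hG
  · simpa using hL.trans hlam

theorem mk_skTerm_le {G : Type} {lam : Cardinal.{0}} (hlam : ℵ₀ ≤ lam) (hL : L.card ≤ ℵ₀)
    (hG : Cardinal.mk G ≤ lam) : Cardinal.mk ((SkL L).Term G) ≤ lam := by
  refine Term.card_le.trans (max_le hlam ?_)
  rw [Cardinal.mk_sum]
  simp only [Cardinal.lift_id]
  refine Cardinal.add_le_of_le hlam hG ?_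
  rw [Cardinal.mk_sigma]
  refine (Cardinal.sum_le_sum _ (fun _ => ℵ₀) fun i => ?_).trans ?_
  · exact mk_bounded_le (L := L) le_rfl hL (G := Fin i) (by simp) 1
  · simpa using hlam

/-- Witness functions in an ordinary structure. -/
@[reducible] noncomputable def skStr (N : Type) [L.Structure N] [Nonempty N] : (SkL L).Structure N where
  funMap := fun {n} (φ : L.BoundedFormula (Fin n) 1) xs =>
    Classical.epsilon fun a => φ.Realize xs (fun _ => a)
  RelMap := fun r => nomatch r

/-- A structure together with an assignment. -/
structure Pt (L : FirstOrder.Language.{0, 0}) (C : Type) : Type 1 where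
  N : Type
  [str : L.Structure N]
  [ne : Nonempty N]
  u : C → N

attribute [instance] Pt.str Pt.ne

/-- A premodel is full (in the inequality sense). -/
def PreFull {C : Type} (v : L.Formula C → B) : Prop :=
  ∀ φ : L.BoundedFormula C 1, ∃ a : C, v φ.ex ≤ v (plug φ fun _ => a)

theorem full_lemma {G : Type} {v : L.Formula G → B} (hv : IsPre v) :
    ∃ v' : L.Formula ((SkL L).Term G) → B, IsPre v' ∧ PreFull v' ∧
      ∀ φ, v' (φ.relabel Term.var) = v φ := by
  let ev : ∀ x : Pt L G, (SkL L).Term G → x.N := fun x t =>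
    letI := skStr (L := L) x.N
    t.realize x.u
  obtain ⟨v', hv', hR⟩ := ext_lemma (B := B) (L := L) (X := Pt L G) (C := (SkL L).Term G)
    (fun x => x.N) ev
    {p | ∃ φ : L.Formula G, p = ({x | φ.Realize x.u}, v φ)} ⟨⊤, by
      simp only [Prod.mk.injEq]
      refine ⟨(Set.eq_univ_of_forall fun x => ?_).symm, (hv.1 _ ?_).symm⟩
      · show Formula.Realize _ _
        simp [Formula.Realize]
      · intro N _ _ u; simp [Formula.Realize]⟩
    (by
      rintro _ ⟨φ, rfl⟩ _ ⟨ψ, rfl⟩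
      refine ⟨φ ⊓ ψ, ?_⟩
      rw [hv.2.2]
      simp only [Prod.mk.injEq, and_true]
      ext x
      simp [Formula.Realize])
    (by
      rintro _ ⟨φ, rfl⟩ h
      apply hv.bot
      intro N _ _ u hu
      exact Set.eq_empty_iff_forall_notMem.1 h ⟨N, u⟩ hu)
  have htop : ∀ φ : L.Formula ((SkL L).Term G), (∀ x, φ.Realize (ev x)) → v' φ = ⊤ := by
    intro φ hφ
    have := hR _ ⟨⊤, rfl⟩ φ (fun x _ => hφ x)
    rw [show v ⊤ = ⊤ from hv.1 _ (fun N _ _ u => by simp [Formula.Realize])] at this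
    exact top_le_iff.1 this
  refine ⟨v', hv', ?_, ?_⟩
  · intro φ
    obtain ⟨n, φ', c, hc⟩ := fin_lemma φ
    let t : (SkL L).Term G := Term.func (L := SkL L) (l := n) φ' c
    refine ⟨t, ?_⟩
    have h := htop (BoundedFormula.imp φ.ex (plug φ fun _ => t)) (by
      intro x
      show Formula.Realize φ.ex (ev x) → Formula.Realize (plug φ fun _ => t) (ev x)
      intro h
      rw [realize_plug]
      rw [realize_ex1] at h
      have : ev x t = Classical.epsilon fun a => φ'.Realize (ev x ∘ c) (fun _ => a) := rfl
      rw [← hc, show (ev x ∘ fun _ : Fin 1 => t) = fun _ => ev x t from rfl, this]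
      apply Classical.epsilon_spec (p := fun a => φ'.Realize (ev x ∘ c) (fun _ => a))
      obtain ⟨a, ha⟩ := h
      exact ⟨a, (hc _ _ _).2 ha⟩)
    have h2 : v' φ.ex = v' (φ.ex ⊓ BoundedFormula.imp φ.ex (plug φ fun _ => t)) := by
      rw [hv'.2.2, h, inf_top_eq]
    rw [h2]
    apply hv'.mono
    intro N _ _ u hu
    simp only [Formula.Realize, BoundedFormula.realize_inf, BoundedFormula.realize_imp] at hu ⊢
    exact hu.2 hu.1
  · intro φ
    apply hv.eq_of_le hv'
    intro φ
    apply hR _ ⟨φ, rfl⟩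
    intro x hx
    rw [Formula.realize_relabel]
    exact hx

theorem IsPre.plug_le_ex {C : Type} {v : L.Formula C → B} (hv : IsPre v)
    (φ : L.BoundedFormula C 1) (a : C) : v (plug φ fun _ => a) ≤ v φ.ex := by
  apply hv.mono
  intro N _ _ u hu
  rw [realize_plug] at hu
  rw [realize_ex1]
  exact ⟨u a, hu⟩

/-- Quotienting a full premodel. -/
theorem quot_lemma {C : Type} {v : L.Formula C → B} (hv : IsPre v) (hf : PreFull v) :
    ∃ (Q : Type) (q : C → Q) (w : L.Formula Q → B), Function.Surjective q ∧ IsBVal w ∧ IsFull w ∧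
      (∀ φ, w (φ.relabel q) = v φ) ∧
      (∀ a b, q a = q b ↔ v (Term.equal (Term.var a) (Term.var b)) = ⊤) := by
  let S : Setoid C := ⟨fun a b => v (Term.equal (Term.var a) (Term.var b)) = ⊤, by
    constructor
    · intro a; apply hv.1; intro N _ _ u; simp
    · intro a b h; rw [← h]; apply hv.congr; intro N _ _ u; simp [eq_comm]
    · intro a b c h1 h2
      apply top_le_iff.1
      have := hv.2.2 (Term.equal (Term.var a) (Term.var b)) (Term.equal (Term.var b) (Term.var c))
      rw [h1, h2, inf_top_eq] at this
      rw [← this]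
      apply hv.mono; intro N _ _ u hu
      rw [Formula.realize_inf] at hu
      simp only [Formula.realize_equal, Term.realize_var] at hu ⊢
      exact hu.1.trans hu.2⟩
  let q : C → Quotient S := Quotient.mk S
  let o : Quotient S → C := Quotient.out
  have hqo : ∀ x, q (o x) = x := fun x => Quotient.out_eq x
  have hq : ∀ a b, q a = q b ↔ v (Term.equal (Term.var a) (Term.var b)) = ⊤ := fun a b =>
    Quotient.eq (r := S)
  have hpre := hv.pull o
  have hfull : IsFull (fun φ : L.Formula (Quotient S) => v (φ.relabel o)) := by
    intro φ
    obtain ⟨a, ha⟩ := hf (φ.subst (Term.var ∘ o))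
    refine ⟨q a, le_antisymm ?_ (hpre.plug_le_ex φ _)⟩
    have h1 : v (Formula.relabel o φ.ex) = v (φ.subst (Term.var ∘ o)).ex := by
      apply hv.congr
      intro N _ _ u
      rw [Formula.realize_relabel, realize_ex1, realize_ex1]
      simp only [BoundedFormula.realize_subst, Function.comp_apply, Term.realize_var]
      rfl
    show v (Formula.relabel o φ.ex) ≤ v _
    rw [h1]
    refine ha.trans ?_
    have h2 : v (plug (φ.subst (Term.var ∘ o)) fun _ => a) =
        v (φ.toFormula.relabel (Sum.elim o fun _ => a)) := by
      apply hv.congr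
      intro N _ _ u
      rw [realize_plug, Formula.realize_relabel, BoundedFormula.realize_toFormula]
      simp only [BoundedFormula.realize_subst, Function.comp_apply, Term.realize_var]
      rfl
    have h3 : v (Formula.relabel o (plug φ fun _ => q a)) =
        v (φ.toFormula.relabel (Sum.elim o fun _ => o (q a))) := by
      apply hv.congr
      intro N _ _ u
      rw [Formula.realize_relabel, realize_plug, Formula.realize_relabel,
        BoundedFormula.realize_toFormula]
      rfl
    rw [h2, h3]
    apply le_of_eq
    apply hv.relabel_congr
    rintro (c | i)
    · apply hv.1; intro N _ _ u; simp
    · rw [← hq]; exact (hqo _).symm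
  refine ⟨Quotient S, q, fun φ => v (φ.relabel o), Quotient.mk_surjective, ?_, ?_, ?_, hq⟩
  rotate_right
  · intro φ
    show v _ = _
    rw [hv.relabel_relabel]
    rw [hv.relabel_congr (o ∘ q) id ?_, hv.relabel_id]
    intro c
    rw [← hq]
    exact hqo _
  · refine ⟨hpre.1, hpre.2.1, hpre.2.2, ?_, ?_⟩
    · intro φ
      apply le_antisymm
      · obtain ⟨a, ha⟩ := hfull φ
        rw [ha]
        exact le_iSup (fun a => v (Formula.relabel o (plug φ fun _ => a))) a
      · exact iSup_le fun a => hpre.plug_le_ex φ a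
    · intro a b hab
      rw [lt_top_iff_ne_top]
      intro h
      apply hab
      rw [← hqo a, ← hqo b, hq, ← h]
      apply hv.congr
      intro N _ _ u
      simp [Formula.realize_relabel]
  · exact hfull

/-- Downward Löwenheim–Skolem. -/
theorem dls_lemma {C G : Type} {lam : Cardinal.{0}} (hlam : ℵ₀ ≤ lam) (hL : L.card ≤ ℵ₀)
    (hG : Cardinal.mk G ≤ lam) {v : L.Formula C → B} (hv : IsBVal v) (hf : IsFull v) (σ : G → C) :
    ∃ K : Set C, Set.range σ ⊆ K ∧ Cardinal.mk K ≤ lam ∧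
      IsBVal (fun φ : L.Formula K => v (φ.relabel Subtype.val)) ∧
      IsFull (fun φ : L.Formula K => v (φ.relabel Subtype.val)) := by
  have hp := IsPre.of_bval hv
  have hw : ∀ (n : ℕ) (φ : L.BoundedFormula (Fin n) 1) (c : Fin n → C), ∃ a : C,
      v (φ.subst (Term.var ∘ c)).ex = v (plug (φ.subst (Term.var ∘ c)) fun _ => a) :=
    fun n φ c => hf _
  choose w hw using hw
  letI : (SkL L).Structure C :=
    { funMap := fun {n} (φ : L.BoundedFormula (Fin n) 1) xs => w n φ xs
      RelMap := fun r => nomatch r }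
  let ev : (SkL L).Term G → C := fun t => t.realize σ
  have hpre := hp.pull (Subtype.val : Set.range ev → C)
  have hfull : IsFull (fun φ : L.Formula (Set.range ev) => v (φ.relabel Subtype.val)) := by
    intro φ
    obtain ⟨n, φ', c, hc⟩ := fin_lemma φ
    choose t ht using fun i => (c i).2
    let t0 : (SkL L).Term G := Term.func (L := SkL L) (l := n) φ' t
    have ht0 : ev t0 = w n φ' (Subtype.val ∘ c) := by
      show w n φ' (fun i => ev (t i)) = _
      congr 1
      funext i; exact ht i
    refine ⟨⟨ev t0, t0, rfl⟩, le_antisymm ?_ (hpre.plug_le_ex φ _)⟩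
    have h1 : v (Formula.relabel Subtype.val φ.ex) =
        v (φ'.subst (Term.var ∘ (Subtype.val ∘ c))).ex := by
      apply hp.congr
      intro N _ _ u
      rw [Formula.realize_relabel, realize_ex1, realize_ex1]
      simp only [BoundedFormula.realize_subst, Function.comp_apply, Term.realize_var, ← hc]
      rfl
    show v (Formula.relabel Subtype.val φ.ex) ≤ v _
    rw [h1, hw, ← ht0]
    apply hp.mono
    intro N _ _ u
    rw [Formula.realize_relabel, realize_plug, realize_plug, ← hc]
    simp only [BoundedFormula.realize_subst, Function.comp_apply, Term.realize_var]
    exact id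
  refine ⟨Set.range ev, ?_, Cardinal.mk_range_le.trans (mk_skTerm_le hlam hL hG), ?_, hfull⟩
  · rintro _ ⟨g, rfl⟩
    exact ⟨Term.var g, rfl⟩
  · refine ⟨hpre.1, hpre.2.1, hpre.2.2, ?_, ?_⟩
    · intro φ
      apply le_antisymm
      · obtain ⟨a, ha⟩ := hfull φ
        rw [ha]
        exact le_iSup (fun a => v (Formula.relabel Subtype.val (plug φ fun _ => a))) a
      · exact iSup_le fun a => hpre.plug_le_ex φ a
    · intro a b hab
      refine lt_of_le_of_lt (le_of_eq ?_) (hv.2.2.2.2 a b (fun h => hab (Subtype.ext h)))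
      apply hp.congr
      intro N _ _ u
      simp [Formula.realize_relabel]

end GU

namespace GU
variable {B : Type} [CompleteBooleanAlgebra B] {L : FirstOrder.Language.{0, 0}}

/-- A type with a multiplicative refinement is realized in an extension. -/
theorem realize_lemma {K I : Type} {v : L.Formula K → B} (hv : IsPre v)
    (e : I → L.BoundedFormula K 1) (b : I → B)
    (hb : ∀ s : Finset I, s.inf b ≤ v (listConj (s.toList.map e)).ex) :
    ∃ v' : L.Formula (Option K) → B, IsPre v' ∧ (∀ φ, v' (φ.relabel some) = v φ) ∧
      ∀ i, b i ≤ v' ((e i).toFormula.relabel (Sum.elim some fun _ => none)) := by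
  classical
  let P : L.Formula K → Finset I → Set (Pt L (Option K)) := fun φ s =>
    {x | φ.Realize (x.u ∘ some) ∧ ∀ i ∈ s, (e i).Realize (x.u ∘ some) (fun _ => x.u none)}
  have htop : v ⊤ = ⊤ := hv.1 _ (fun N _ _ u => by simp [Formula.Realize])
  obtain ⟨v', hv', hR⟩ := ext_lemma (B := B) (L := L) (X := Pt L (Option K)) (C := Option K)
    (fun x => x.N) (fun x => x.u)
    {p | ∃ (φ : L.Formula K) (s : Finset I), p = (P φ s, v φ ⊓ s.inf b)} ⟨⊤, ∅, by
      simp only [Prod.mk.injEq]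
      refine ⟨(Set.eq_univ_of_forall fun x => ?_).symm, ?_⟩
      · refine ⟨?_, by simp⟩
        simp [Formula.Realize]
      · simp [htop]⟩
    (by
      rintro _ ⟨φ, s, rfl⟩ _ ⟨ψ, t, rfl⟩
      refine ⟨φ ⊓ ψ, s ∪ t, ?_⟩
      rw [hv.2.2, Finset.inf_union]
      simp only [Prod.mk.injEq]
      constructor
      · ext x
        simp only [P, Set.mem_inter_iff, Set.mem_setOf_eq, Formula.realize_inf, Finset.mem_union,
          or_imp, forall_and]
        tauto
      · exact inf_inf_inf_comm _ _ _ _)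
    (by
      rintro _ ⟨φ, s, rfl⟩ h
      show v φ ⊓ s.inf b = ⊥
      rw [eq_bot_iff]
      refine (inf_le_inf_left _ (hb s)).trans (le_of_eq ?_)
      apply hv.inf_bot
      intro N _ _ u h1 h2
      rw [realize_ex1] at h2
      obtain ⟨a, ha⟩ := h2
      rw [realize_listConj] at ha
      refine Set.eq_empty_iff_forall_notMem.1 h ⟨N, fun o => o.elim a u⟩ ⟨h1, ?_⟩
      intro i hi
      exact ha _ (List.mem_map.2 ⟨i, Finset.mem_toList.2 hi, rfl⟩))
  refine ⟨v', hv', ?_, ?_⟩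
  · apply hv.eq_of_le hv'
    intro φ
    refine le_trans (le_of_eq ?_) (hR _ ⟨φ, ∅, rfl⟩ _ ?_)
    · simp
    · rintro x ⟨hx, -⟩
      rw [Formula.realize_relabel]
      exact hx
  · intro i
    refine le_trans (le_of_eq ?_) (hR _ ⟨⊤, {i}, rfl⟩ _ ?_)
    · simp [htop]
    · rintro x ⟨-, hx⟩
      rw [Formula.realize_relabel, BoundedFormula.realize_toFormula]
      exact hx i (by simp)

theorem BModels.of_elem {C D : Type} {v : L.Formula C → B} {w : L.Formula D → B} (hw : IsPre w)
    (e : C → D) (h : ∀ φ, w (φ.relabel e) = v φ) (T : L.Theory) (hT : BModels v T) :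
    BModels w T := by
  intro φ hφ
  rw [← hT φ hφ, ← h, hw.relabel_relabel]
  congr 1
  congr 1
  funext x
  exact x.elim

theorem BModels.to_elem {C D : Type} {v : L.Formula C → B} {w : L.Formula D → B} (hw : IsPre w)
    (e : C → D) (h : ∀ φ, w (φ.relabel e) = v φ) (T : L.Theory) (hT : BModels w T) :
    BModels v T := by
  intro φ hφ
  rw [← hT φ hφ, ← h, hw.relabel_relabel]
  congr 1
  congr 1
  funext x
  exact x.elim

theorem good_saturates {lam : Cardinal.{0}} (hlam : ℵ₀ ≤ lam) {U : Set B}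
    (hU : IsBUltrafilter U) (hg : IsGoodFilter U lam) (hL : L.card ≤ ℵ₀) (T : L.Theory) :
    Saturates U T lam := by
  classical
  intro C val hM hsat N _ π hπ A hA p hp
  obtain ⟨hbv, hfull, hT⟩ := hM
  have hpre := IsPre.of_bval hbv
  obtain ⟨b0, hb0⟩ := hp ∅ (by simp)
  rcases p.eq_empty_or_nonempty with rfl | hpne
  · exact ⟨b0, by simp⟩
  haveI : Nonempty N := ⟨b0⟩
  choose σ hσ using fun a : A => hπ.1 a.1
  obtain ⟨K, hσK, hK, hKb, hKf⟩ := dls_lemma hlam hL hA hbv hfull σ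
  set v0 : L.Formula K → B := fun φ => val (φ.relabel Subtype.val) with hv0
  have hp0 : IsPre v0 := hpre.pull _
  -- enumeration of the type
  have hpc : Cardinal.mk p ≤ Cardinal.mk (Quotient.out lam) := by
    rw [Cardinal.mk_out]
    exact (Cardinal.mk_set_le p).trans (mk_bounded_le hlam hL hA 1)
  obtain ⟨⟨j, hj⟩⟩ := hpc
  haveI : Nonempty p := hpne.to_subtype
  let en : Quotient.out lam → p := Function.invFun j
  have hen : Function.Surjective en := Function.invFun_surjective hj
  let τ : A → K := fun a => ⟨σ a, hσK ⟨a, rfl⟩⟩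
  have hτ : ∀ a, π (τ a).1 = a.1 := hσ
  let e : Quotient.out lam → L.BoundedFormula K 1 := fun i => (en i).1.subst (Term.var ∘ τ)
  have he : ∀ i (x : N), (e i).Realize (fun k : K => π k.1) (fun _ => x) ↔
      (en i).1.Realize Subtype.val (fun _ => x) := by
    intro i x
    simp only [e, BoundedFormula.realize_subst, Function.comp_apply, Term.realize_var, hτ]
  let Ad : Finset (Quotient.out lam) → B := fun s => v0 (listConj (s.toList.map e)).ex
  have hAU : InFilter Ad U := by
    intro s
    show val _ ∈ U
    rw [hπ.2, Formula.realize_relabel, realize_ex1]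
    obtain ⟨x, hx⟩ := hp (s.image fun i => (en i).1) (by
      intro φ hφ
      obtain ⟨i, -, rfl⟩ := Finset.mem_image.1 (Finset.mem_coe.1 hφ)
      exact (en i).2)
    refine ⟨x, ?_⟩
    rw [realize_listConj]
    intro φ hφ
    obtain ⟨i, hi, rfl⟩ := List.mem_map.1 hφ
    exact (he i x).2 (hx _ (Finset.mem_image.2 ⟨i, Finset.mem_toList.1 hi, rfl⟩))
  have hAd : IsDistribution Ad := by
    refine ⟨?_, fun s h => hU.1.2.1 (h ▸ hAU s), ?_⟩
    · apply hp0.1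
      intro N _ _ u
      rw [realize_ex1]
      exact ⟨Classical.arbitrary N, by simp [listConj]⟩
    · intro s t hst
      apply hp0.mono
      intro N _ _ u
      rw [realize_ex1, realize_ex1]
      rintro ⟨x, hx⟩
      refine ⟨x, ?_⟩
      rw [realize_listConj] at hx ⊢
      intro φ hφ
      obtain ⟨i, hi, rfl⟩ := List.mem_map.1 hφ
      exact hx _ (List.mem_map.2 ⟨i, Finset.mem_toList.2 (hst (Finset.mem_toList.1 hi)), rfl⟩)
  obtain ⟨A', hA'd, hA'm, hA'U, hA'r⟩ := hg Ad hAd hAU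
  obtain ⟨v1, hv1, hv10, hv1e⟩ := realize_lemma hp0 e (fun i => A' {i}) (by
    intro s
    rw [← hA'm s]
    exact hA'r s)
  obtain ⟨v2, hv2, hv2f, hv21⟩ := full_lemma hv1
  obtain ⟨Q, q, w, hqs, hwb, hwf, hw2, -⟩ := quot_lemma hv2 hv2f
  have hwp := IsPre.of_bval hwb
  let g1 : Option K → Q := fun x => q (Term.var x)
  have hg1 : ∀ φ, w (φ.relabel g1) = v1 φ := by
    intro φ
    rw [← hv21, ← hw2, hwp.relabel_relabel]
    rfl
  have hg0 : ∀ φ, w (φ.relabel (g1 ∘ some)) = v0 φ := by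
    intro φ
    rw [← hv10, ← hg1, hwp.relabel_relabel]
  have hcard : Cardinal.mk Q ≤ lam := by
    refine (Cardinal.mk_le_of_surjective hqs).trans (mk_skTerm_le hlam hL ?_)
    rw [Cardinal.mk_option]
    exact Cardinal.add_le_of_le hlam hK (Cardinal.one_le_aleph0.trans hlam)
  have hT0 : BModels v0 T := BModels.to_elem hpre Subtype.val (fun _ => rfl) T hT
  obtain ⟨g, hg, hgι⟩ := hsat K Q v0 w ⟨hKb, hKf, hT0⟩
    ⟨hwb, hwf, BModels.of_elem hwp (g1 ∘ some) hg0 T hT0⟩ hcard (g1 ∘ some)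
    (fun φ => (hg0 φ).symm) Subtype.val (fun φ => rfl)
  refine ⟨π (g (g1 none)), ?_⟩
  intro φ hφ
  obtain ⟨i, hi⟩ := hen ⟨φ, hφ⟩
  have hmem : val (((e i).toFormula.relabel (Sum.elim some fun _ => none)).relabel (g ∘ g1)) ∈ U := by
    refine hU.1.2.2.1 _ _ (hA'U {i}) ((hv1e i).trans (le_of_eq ?_))
    rw [← hg1, hg, hpre.relabel_relabel]
  rw [hπ.2, Formula.realize_relabel, Formula.realize_relabel, BoundedFormula.realize_toFormula] at hmem
  have := (he i (π (g (g1 none)))).1 (by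
    convert hmem using 1
    · funext k
      exact congrArg π (congrFun hgι k).symm
    · rfl)
  rw [hi] at this
  exact this

end GU

namespace GU
variable {B : Type} [CompleteBooleanAlgebra B]
variable {L : FirstOrder.Language.{0, 0}}

/-- Tree-like names for the elements of a saturated model. -/
inductive W (L : FirstOrder.Language.{0, 0}) (B I : Type) : Type
  | mk (v : L.Formula I → B) (D : Set I) (f : D → W L B I) (i : I) : W L B I

/-- Agreement of two premodels on a set of parameters. -/
def Agree {Z : Type} (S : Set Z) (v v' : L.Formula Z → B) : Prop :=
  ∀ (C : Type) (e : C → Z), (∀ c, e c ∈ S) → ∀ φ : L.Formula C,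
    v' (φ.relabel e) = v (φ.relabel e)

/-- The amalgamation problem `(v1, D, f)` is solved inside `(S, v)`. -/
def Solved {I : Type} (S : Set (W L B I)) (v : L.Formula (W L B I) → B)
    (v1 : L.Formula I → B) (D : Set I) (f : D → W L B I) : Prop :=
  (∀ j, W.mk v1 D f j ∈ S) ∧ (∀ d, f d ∈ S) ∧
  (∀ φ : L.Formula I, v (φ.relabel (W.mk v1 D f)) = v1 φ) ∧
  ∀ d : D, v (Term.equal (Term.var (f d)) (Term.var (W.mk v1 D f d))) = ⊤

/-- Values of equalities under agreement. -/
theorem Agree.equal {Z : Type} {S : Set Z} {v v' : L.Formula Z → B} (h : Agree S v v')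
    (hv : IsPre v) (hv' : IsPre v') {a b : Z} (ha : a ∈ S) (hb : b ∈ S) :
    v' (Term.equal (Term.var a) (Term.var b)) = v (Term.equal (Term.var a) (Term.var b)) := by
  have := h (Fin 2) ![a, b] (by intro c; fin_cases c <;> simpa)
    (Term.equal (Term.var 0) (Term.var 1))
  have e : ∀ w : L.Formula Z → B, IsPre w → w (Formula.relabel ![a, b]
      (Term.equal (Term.var 0) (Term.var 1) : L.Formula (Fin 2))) =
      w (Term.equal (Term.var a) (Term.var b)) := by
    intro w hw
    apply hw.congr
    intro N _ _ u
    rw [Formula.realize_relabel]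
    simp
  rwa [e _ hv, e _ hv'] at this

theorem Solved.mono {I : Type} {S S' : Set (W L B I)} {v v' : L.Formula (W L B I) → B}
    (hv : IsPre v) (hv' : IsPre v') (hS : S ⊆ S') (ha : Agree S v v')
    {v1 : L.Formula I → B} {D : Set I} {f : D → W L B I} (h : Solved S v v1 D f) :
    Solved S' v' v1 D f := by
  refine ⟨fun j => hS (h.1 j), fun d => hS (h.2.1 d), fun φ => ?_, fun d => ?_⟩
  · rw [ha _ _ h.1, h.2.2.1]
  · rw [ha.equal hv hv' (h.2.1 d) (h.1 _), h.2.2.2]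

/-- Stages of the construction of a saturated model. -/
structure St (L : FirstOrder.Language.{0, 0}) (B I : Type) [CompleteBooleanAlgebra B] : Type where
  S : Set (W L B I)
  v : L.Formula (W L B I) → B
  hv : IsPre v
  inv : ∀ v1 D f i, W.mk v1 D f i ∈ S → Solved S v v1 D f

instance {I : Type} : Preorder (St L B I) where
  le x y := x.S ⊆ y.S ∧ Agree x.S x.v y.v
  le_refl x := ⟨subset_rfl, fun _ _ _ _ => rfl⟩
  le_trans x y z h1 h2 := ⟨h1.1.trans h2.1, fun C e he φ =>
    (h2.2 C e (fun c => h1.1 (he c)) φ).trans (h1.2 C e he φ)⟩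

theorem agree_of_le {Z : Type} {S : Set Z} {v v' : L.Formula Z → B} (hv : IsPre v)
    (hv' : IsPre v') (h : ∀ φ : L.Formula S, v (φ.relabel Subtype.val) ≤ v' (φ.relabel Subtype.val)) :
    Agree S v v' := by
  intro C e he φ
  have h1 := (hv.pull (Subtype.val : S → Z)).eq_of_le hv' Subtype.val h
    (φ.relabel (fun c => ⟨e c, he c⟩))
  rw [hv.relabel_relabel, hv'.relabel_relabel] at h1
  exact h1

theorem chain_ub {I : Type} (c : Set (St L B I)) (hc : IsChain (· ≤ ·) c) (y : St L B I)
    (hy : y ∈ c) : ∃ ub, ∀ z ∈ c, z ≤ ub := by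
  obtain ⟨v', hv', hR⟩ := ext_lemma (B := B) (L := L) (X := Pt L (W L B I)) (C := W L B I)
    (fun x => x.N) (fun x => x.u)
    {p | ∃ z ∈ c, ∃ φ : L.Formula z.S, p =
      ({x | φ.Realize (x.u ∘ Subtype.val)}, z.v (φ.relabel Subtype.val))} (by
      refine ⟨y, hy, ⊤, ?_⟩
      have : y.v ((⊤ : L.Formula y.S).relabel Subtype.val) = ⊤ :=
        (y.hv.pull Subtype.val).1 ⊤ (fun N _ _ u => by simp [Formula.Realize])
      rw [this]
      ext x <;> simp [Formula.Realize]) (by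
      rintro _ ⟨z1, hz1, φ1, rfl⟩ _ ⟨z2, hz2, φ2, rfl⟩
      obtain ⟨z, hz, h1, h2⟩ := hc.directedOn z1 hz1 z2 hz2
      refine ⟨z, hz, φ1.relabel (Set.inclusion h1.1) ⊓ φ2.relabel (Set.inclusion h2.1), ?_⟩
      refine Prod.ext ?_ ?_
      · ext x
        have : ∀ φ ψ : L.Formula z.S, (φ ⊓ ψ).Realize (x.u ∘ Subtype.val) ↔
          φ.Realize (x.u ∘ Subtype.val) ∧ ψ.Realize (x.u ∘ Subtype.val) := by
            intro φ ψ; simp [Formula.Realize]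
        simp only [Set.mem_inter_iff, Set.mem_setOf_eq, this, Formula.realize_relabel]
        rfl
      · have := (z.hv.pull (Subtype.val : z.S → _)).2.2 (φ1.relabel (Set.inclusion h1.1))
          (φ2.relabel (Set.inclusion h2.1))
        simp only at this ⊢
        rw [this, z.hv.relabel_relabel, z.hv.relabel_relabel]
        rw [← h1.2 _ _ (fun c => c.2), ← h2.2 _ _ (fun c => c.2)]
        rfl) (by
      rintro _ ⟨z, hz, φ, rfl⟩ h
      apply z.hv.bot
      intro N _ _ u hu
      rw [Formula.realize_relabel] at hu
      have : (⟨N, u⟩ : Pt L (W L B I)) ∈ (∅ : Set (Pt L (W L B I))) := by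
        rw [← h]; exact hu
      exact this)
  have hag : ∀ z ∈ c, Agree z.S z.v v' := by
    intro z hz
    apply agree_of_le z.hv hv'
    intro φ
    refine hR _ ⟨z, hz, φ, rfl⟩ _ ?_
    intro x hx
    rw [Formula.realize_relabel]
    exact hx
  refine ⟨⟨⋃ z ∈ c, z.S, v', hv', ?_⟩, fun z hz => ⟨Set.subset_biUnion_of_mem (u := fun z : St L B I => z.S) hz, hag z hz⟩⟩
  intro v1 D f i hi
  simp only [Set.mem_iUnion] at hi
  obtain ⟨z, hz, hi⟩ := hi
  exact (z.inv v1 D f i hi).mono z.hv hv'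
    (Set.subset_biUnion_of_mem (u := fun z : St L B I => z.S) hz) (hag z hz)

theorem one_step {Z I : Type} {v : L.Formula Z → B} (hv : IsPre v) (S : Set Z) (m : I → Z)
    (hm : Function.Injective m) (hmS : ∀ i, m i ∉ S) {v1 : L.Formula I → B} (hv1 : IsPre v1)
    (D : Set I) (f : D → Z) (hf : ∀ d, f d ∈ S)
    (hel : ∀ φ : L.Formula D, v (φ.relabel f) = v1 (φ.relabel Subtype.val)) :
    ∃ v' : L.Formula Z → B, IsPre v' ∧ Agree S v v' ∧ (∀ φ : L.Formula I, v' (φ.relabel m) = v1 φ) ∧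
      ∀ d : D, v' (Term.equal (Term.var (f d)) (Term.var (m d))) = ⊤ := by
  classical
  have rinf : ∀ (A N : Type) [L.Structure N] (φ ψ : L.Formula A) (u : A → N),
      (φ ⊓ ψ).Realize u ↔ φ.Realize u ∧ ψ.Realize u := by
    intro A N _ φ ψ u; simp [Formula.Realize]
  have vt : v ((⊤ : L.Formula S).relabel Subtype.val) = ⊤ :=
    (hv.pull Subtype.val).1 ⊤ (fun N _ _ u => by simp [Formula.Realize])
  have v1t : v1 (⊤ : L.Formula I) = ⊤ := hv1.1 ⊤ (fun N _ _ u => by simp [Formula.Realize])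
  have rt : ∀ (A N : Type) [L.Structure N] (u : A → N), (⊤ : L.Formula A).Realize u := by
    intro A N _ u; simp [Formula.Realize]
  obtain ⟨v', hv', hR⟩ := ext_lemma (B := B) (L := L)
    (X := {x : Pt L Z // ∀ d, x.u (f d) = x.u (m d)}) (C := Z)
    (fun x => x.1.N) (fun x => x.1.u)
    {p | ∃ (φ : L.Formula S) (ψ : L.Formula I), p =
      ({x | φ.Realize (x.1.u ∘ Subtype.val) ∧ ψ.Realize (x.1.u ∘ m)},
        v (φ.relabel Subtype.val) ⊓ v1 ψ)} (by
      refine ⟨⊤, ⊤, ?_⟩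
      rw [vt, v1t]
      refine Prod.ext ?_ (by simp)
      ext x
      simp [rt]) (by
      rintro _ ⟨φ1, ψ1, rfl⟩ _ ⟨φ2, ψ2, rfl⟩
      refine ⟨φ1 ⊓ φ2, ψ1 ⊓ ψ2, ?_⟩
      refine Prod.ext ?_ ?_
      · ext x
        simp only [Set.mem_inter_iff, Set.mem_setOf_eq, rinf]
        tauto
      · have := (hv.pull (Subtype.val : S → _)).2.2 φ1 φ2
        simp only at this ⊢
        rw [this, hv1.2.2]
        exact inf_inf_inf_comm _ _ _ _) (by
      rintro _ ⟨φ, ψ, rfl⟩ h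
      obtain ⟨χ, hχ⟩ := exi_lemma (ψ.relabel
        (fun i => if h : i ∈ D then Sum.inl (⟨i, h⟩ : D) else Sum.inr i))
      have h1 : v1 ψ ≤ v (χ.relabel f) := by
        rw [hel]
        apply hv1.mono
        intro N _ _ u hu
        rw [Formula.realize_relabel, hχ]
        refine ⟨u, ?_⟩
        rw [Formula.realize_relabel]
        convert hu using 1
        funext i
        by_cases hi : i ∈ D <;> simp [hi]
      refine le_bot_iff.1 ((inf_le_inf_left _ h1).trans (le_of_eq ?_))
      apply hv.inf_bot
      intro N _ _ u hu1 hu2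
      rw [Formula.realize_relabel] at hu1 hu2
      rw [hχ] at hu2
      obtain ⟨z, hz⟩ := hu2
      rw [Formula.realize_relabel] at hz
      let w : I → N := Sum.elim (u ∘ f) z ∘
        (fun i => if h : i ∈ D then Sum.inl (⟨i, h⟩ : D) else Sum.inr i)
      have hwD : ∀ d : D, w d = u (f d) := by
        intro d
        simp [w]
      let u' : Z → N := Function.extend m w u
      have hu'm : ∀ i, u' (m i) = w i := fun i => hm.extend_apply _ _ _
      have hu'S : ∀ s ∈ S, u' s = u s := fun s hs => Function.extend_apply' _ _ _ (by
        rintro ⟨i, rfl⟩; exact hmS i hs)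
      let x : {x : Pt L Z // ∀ d, x.u (f d) = x.u (m d)} := ⟨⟨N, u'⟩, fun d => by
        simp only
        rw [hu'm, hwD, hu'S _ (hf d)]⟩
      have : x ∈ (∅ : Set {x : Pt L Z // ∀ d, x.u (f d) = x.u (m d)}) := by
        rw [← h]
        refine ⟨?_, ?_⟩
        · convert hu1 using 1
          funext s
          exact hu'S _ s.2
        · convert hz using 1
          funext i
          exact hu'm i
      exact this)
  refine ⟨v', hv', ?_, ?_, ?_⟩
  · apply agree_of_le hv hv'
    intro φ
    refine le_trans (le_of_eq ?_) (hR _ ⟨φ, ⊤, rfl⟩ _ ?_)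
    · simp [v1t]
    · intro x hx
      rw [Formula.realize_relabel]
      exact hx.1
  · apply hv1.eq_of_le hv'
    intro ψ
    refine le_trans (le_of_eq ?_) (hR _ ⟨⊤, ψ, rfl⟩ _ ?_)
    · simp [vt]
    · intro x hx
      rw [Formula.realize_relabel]
      exact hx.2
  · intro d
    rw [eq_top_iff]
    refine le_trans (le_of_eq ?_) (hR _ ⟨⊤, ⊤, rfl⟩ _ ?_)
    · simp [vt, v1t]
    · intro x _
      have := x.2 d
      simpa using this

theorem W.mk_injective {I : Type} (v1 : L.Formula I → B) (D : Set I) (f : D → W L B I) :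
    Function.Injective (W.mk v1 D f) := by
  intro i j h
  injection h

theorem max_solved {I : Type} {z : St L B I} (hz : IsMax z) {v1 : L.Formula I → B} (hv1 : IsPre v1)
    [Nonempty I] (D : Set I) (f : D → W L B I) (hf : ∀ d, f d ∈ z.S)
    (hel : ∀ φ : L.Formula D, z.v (φ.relabel f) = v1 (φ.relabel Subtype.val)) :
    Solved z.S z.v v1 D f := by
  by_cases h : ∃ i, W.mk v1 D f i ∈ z.S
  · obtain ⟨i, hi⟩ := h
    exact z.inv _ _ _ _ hi
  push Not at h
  obtain ⟨v', hv', ha, h1, h2⟩ := one_step z.hv z.S (W.mk v1 D f) (W.mk_injective _ _ _) h hv1 D f hf hel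
  have hs : Solved (z.S ∪ Set.range (W.mk v1 D f)) v' v1 D f :=
    ⟨fun j => Or.inr ⟨j, rfl⟩, fun d => Or.inl (hf d), h1, h2⟩
  let z' : St L B I := ⟨z.S ∪ Set.range (W.mk v1 D f), v', hv', by
    rintro v2 D2 f2 i (hi | ⟨j, hj⟩)
    · exact (z.inv _ _ _ _ hi).mono z.hv hv' Set.subset_union_left ha
    · cases hj
      exact hs⟩
  have hle : z ≤ z' := ⟨Set.subset_union_left, ha⟩
  obtain ⟨i⟩ := ‹Nonempty I›
  exact absurd ((hz hle).1 (Or.inr ⟨i, rfl⟩)) (h i)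

theorem max_sat {I : Type} [Nonempty I] {z : St L B I} (hz : IsMax z) {C0 C1 : Type}
    {v1 : L.Formula C1 → B} (hv1 : IsPre v1) [Nonempty C1] (hC : Cardinal.mk C1 ≤ Cardinal.mk I)
    (ι : C0 → C1) (hι : Function.Injective ι) (f : C0 → W L B I) (hf : ∀ c, f c ∈ z.S)
    (hel : ∀ φ : L.Formula C0, z.v (φ.relabel f) = v1 (φ.relabel ι)) :
    ∃ g : C1 → W L B I, (∀ c, g c ∈ z.S) ∧ (∀ φ, z.v (φ.relabel g) = v1 φ) ∧
      ∀ c, z.v (Term.equal (Term.var (f c)) (Term.var (g (ι c)))) = ⊤ := by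
  obtain ⟨s⟩ := hC
  let e : I → C1 := Function.invFun s
  have hes : ∀ c, e (s c) = c := Function.leftInverse_invFun s.injective
  let k := Equiv.ofInjective (s ∘ ι) (s.injective.comp hι)
  have hs := max_solved hz (hv1.pull e) (Set.range (s ∘ ι)) (f ∘ k.symm) (fun d => hf _) (by
    intro φ
    have := hel (φ.relabel k.symm)
    rw [z.hv.relabel_relabel] at this
    rw [this, hv1.relabel_relabel, hv1.relabel_relabel]
    congr 2
    funext d
    obtain ⟨c, rfl⟩ := k.surjective d
    have hk : (k c : I) = s (ι c) := rfl
    simp only [Function.comp, Equiv.symm_apply_apply, hk, hes])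
  refine ⟨fun c => W.mk _ _ _ (s c), fun c => hs.1 _, fun φ => ?_, fun c => ?_⟩
  · have := hs.2.2.1 (φ.relabel s)
    rw [z.hv.relabel_relabel] at this
    refine this.trans ((hv1.relabel_relabel _ _ _).trans ?_)
    have h2 : e ∘ s = id := funext hes
    rw [h2, hv1.relabel_id]
  · have := hs.2.2.2 (k c)
    simp only [Function.comp, Equiv.symm_apply_apply] at this
    exact this

/-- Existence of saturated full models. -/
theorem exists_sat (P : Type) [L.Structure P] [Nonempty P] {lam : Cardinal.{0}} (hlam : ℵ₀ ≤ lam)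
    (hL : L.card ≤ ℵ₀) : ∃ (Q : Type) (w : L.Formula Q → B),
      IsFullBModel (L.completeTheory P) w ∧ BSaturated (L.completeTheory P) lam w ∧
      ∀ v1 : L.Formula (Quotient.out lam) → B, IsPre v1 →
        (∀ φ : L.Sentence, P ⊨ φ → v1 (φ.relabel (fun e : Empty => e.elim)) = ⊤) →
        ∃ g : Quotient.out lam → Q, ∀ φ, w (φ.relabel g) = v1 φ := by
  classical
  let I := Quotient.out lam
  have hI : Cardinal.mk I = lam := Cardinal.mk_out lam
  haveI : Nonempty I := by
    rw [← Cardinal.mk_ne_zero_iff, hI]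
    exact (lt_of_lt_of_le Cardinal.aleph0_pos hlam).ne'
  let p0 : P := Classical.arbitrary P
  let x0 : St L B I := ⟨∅, fun φ => if φ.Realize (fun _ => p0) then ⊤ else ⊥, by
    refine ⟨fun φ h => by simp [h P], fun φ => ?_, fun φ ψ => ?_⟩
    · by_cases h : φ.Realize (fun _ => p0) <;> simp [h]
    · by_cases h : φ.Realize (fun _ => p0) <;> by_cases h' : ψ.Realize (fun _ => p0) <;>
        simp_all [Formula.Realize], fun _ _ _ _ h => h.elim⟩
  obtain ⟨z, hx0, hz⟩ := zorn_le_nonempty_Ici₀ x0 (fun c _ hc y hy => chain_ub c hc y hy) x0 le_rfl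
  have hT : ∀ φ : L.Sentence, P ⊨ φ → z.v (φ.relabel (fun e : Empty => e.elim)) = ⊤ := by
    intro φ hφ
    rw [hx0.2 Empty _ (fun e => e.elim) φ]
    have : (Formula.relabel (fun e : Empty => (e.elim : W L B I)) φ).Realize (fun _ => p0) := by
      rw [Formula.realize_relabel]
      convert hφ
      rw [Sentence.Realize, Formula.Realize, Formula.Realize]
      congr!
    exact if_pos this
  let vS : L.Formula z.S → B := fun φ => z.v (φ.relabel Subtype.val)
  have hvS : IsPre vS := z.hv.pull _
  have hfull : PreFull vS := by
    intro φ
    obtain ⟨n, φ', c, hc⟩ := fin_lemma φ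
    obtain ⟨v', hv', hf', hvv⟩ := full_lemma (hvS.pull c)
    let Φ : L.BoundedFormula ((SkL L).Term (Fin n)) 1 := φ'.subst (Term.var ∘ Term.var)
    have hΦ : ∀ (N : Type) [L.Structure N] (u : (SkL L).Term (Fin n) → N) (xs : Fin 1 → N),
        Φ.Realize u xs ↔ φ'.Realize (u ∘ Term.var) xs := by
      intro N _ u xs
      simp only [Φ, BoundedFormula.realize_subst]
      rfl
    obtain ⟨a, ha⟩ := hf' Φ
    haveI : Nonempty ((SkL L).Term (Fin n)) := ⟨a⟩
    obtain ⟨g, hg, hgv, hge⟩ := max_sat hz hv' (by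
      rw [hI]; exact mk_skTerm_le hlam hL (by simpa using (Cardinal.natCast_lt_aleph0.le.trans hlam)))
      (Term.var : Fin n → (SkL L).Term (Fin n)) (fun i j h => by simpa using h) (fun i => (c i : W L B I))
      (fun i => (c i).2) (fun ψ => by
        rw [hvv]
        exact (z.hv.relabel_relabel _ _ _).symm)
    refine ⟨⟨g a, hg a⟩, ?_⟩
    have e1 : vS φ.ex = v' Φ.ex := by
      have h1 : v' (Formula.relabel Term.var φ'.ex) = v' Φ.ex := by
        apply hv'.congr
        intro N _ _ u
        rw [Formula.realize_relabel, realize_ex1, realize_ex1]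
        simp only [hΦ]
      rw [← h1, hvv]
      apply hvS.congr
      intro N _ _ u
      rw [Formula.realize_relabel, realize_ex1, realize_ex1]
      simp only [hc]
    rw [e1]
    refine ha.trans (le_of_eq ?_)
    rw [← hgv]
    have e2 : z.v (Formula.relabel g (plug Φ fun _ => a)) =
        z.v (φ'.toFormula.relabel (Sum.elim (fun i => g (Term.var i)) (fun _ => g a))) := by
      apply z.hv.congr
      intro N _ _ u
      rw [Formula.realize_relabel, realize_plug, hΦ, Formula.realize_relabel,
        BoundedFormula.realize_toFormula]
      rfl
    have e3 : vS (plug φ fun _ => ⟨g a, hg a⟩) =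
        z.v (φ'.toFormula.relabel (Sum.elim (fun i => (c i : W L B I)) (fun _ => g a))) := by
      apply z.hv.congr
      intro N _ _ u
      rw [Formula.realize_relabel, realize_plug, ← hc, Formula.realize_relabel,
        BoundedFormula.realize_toFormula]
      rfl
    rw [e2, e3]
    symm
    apply z.hv.relabel_congr
    rintro (i | i)
    · exact hge i
    · apply z.hv.1
      intro N _ _ u
      simp
  obtain ⟨Q, q, w, hq, hwb, hwf, hwq, hqe⟩ := quot_lemma hvS hfull
  have hwp := IsPre.of_bval hwb
  let σ : Q → z.S := Function.surjInv hq
  have hσ : ∀ a, q (σ a) = a := Function.surjInv_eq hq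
  have hTS : BModels vS (L.completeTheory P) := by
    intro φ hφ
    rw [← hT φ hφ]
    refine (z.hv.relabel_relabel _ _ _).trans ?_
    congr 2
    funext e
    exact e.elim
  have hwT : BModels w (L.completeTheory P) := BModels.of_elem hwp q hwq _ hTS
  have heq : ∀ (a b : z.S), z.v (Term.equal (Term.var a.1) (Term.var b.1)) = ⊤ →
      q a = q b := by
    intro a b h
    rw [hqe, ← h]
    apply z.hv.congr
    intro N _ _ u
    rw [Formula.realize_relabel]
    simp
  refine ⟨Q, w, ⟨hwb, hwf, hwT⟩, ?_, ?_⟩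
  · intro C0 C1 v0 v1 h0 h1 hC1 ι hι f hf
    have hp1 := IsPre.of_bval h1.1
    have hp0 := IsPre.of_bval h0.1
    obtain ⟨a1, -⟩ := h1.2.1 ⊤
    haveI : Nonempty C1 := ⟨a1⟩
    have hinj : Function.Injective ι := by
      intro a b hab
      by_contra hne
      have := h0.1.2.2.2.2 a b hne
      rw [hι] at this
      refine this.ne ?_
      apply hp1.1
      intro N _ _ u
      rw [Formula.realize_relabel]
      simp [hab]
    obtain ⟨g, hg, hgv, hge⟩ := max_sat hz hp1 (hI ▸ hC1) ι hinj (fun c => (σ (f c) : W L B I))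
      (fun c => (σ (f c)).2) (fun φ => by
        rw [← hι, hf]
        have := hwq (φ.relabel (σ ∘ f))
        rw [hwp.relabel_relabel] at this
        have e : q ∘ σ ∘ f = f := funext fun c => hσ _
        rw [e] at this
        rw [this]
        exact (z.hv.relabel_relabel _ _ _).symm)
    refine ⟨fun c => q ⟨g c, hg c⟩, fun φ => ?_, ?_⟩
    · rw [← hgv]
      have := hwq (φ.relabel (fun c => (⟨g c, hg c⟩ : z.S)))
      rw [hwp.relabel_relabel] at this
      refine Eq.trans ?_ this.symm
      exact (z.hv.relabel_relabel (fun c => (⟨g c, hg c⟩ : z.S)) Subtype.val φ).symm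
    · funext c
      have := heq _ ⟨g (ι c), hg _⟩ (hge c)
      rw [hσ] at this
      exact this.symm
  · intro v1 hv1 hTv
    obtain ⟨g, hg, hgv, -⟩ := max_sat hz hv1 le_rfl (fun e : Empty => (e.elim : I))
      (fun e => e.elim) (fun e => e.elim) (fun e => e.elim) (fun φ => by
        by_cases h : P ⊨ (φ : L.Sentence)
        · rw [hT φ h, hTv φ h]
        · have h' : P ⊨ (Formula.not φ : L.Sentence) := by
            simpa [Sentence.Realize] using h
          have a1 := hT _ h'
          have a2 := hTv _ h'
          rw [← compl_inj_iff]
          exact ((z.hv.pull _).2.1 φ).symm.trans (a1.trans (a2.symm.trans ((hv1.pull _).2.1 φ))))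
    refine ⟨fun c => q ⟨g c, hg c⟩, fun φ => ?_⟩
    rw [← hgv]
    have := hwq (φ.relabel (fun c => (⟨g c, hg c⟩ : z.S)))
    rw [hwp.relabel_relabel] at this
    refine Eq.trans this ?_
    exact (z.hv.relabel_relabel _ _ _)

end GU

namespace GU
variable {B : Type} [CompleteBooleanAlgebra B]
variable {L : FirstOrder.Language.{0, 0}}

theorem ultra_compl {U : Set B} (hU : IsBUltrafilter U) (a : B) : aᶜ ∈ U ↔ a ∉ U := by
  constructor
  · intro h h'
    have := hU.1.2.2.2 _ _ h h'
    rw [compl_inf_eq_bot] at this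
    exact hU.1.2.1 this
  · intro h
    exact (hU.2 a).resolve_left h

theorem ultra_inf {U : Set B} (hU : IsBUltrafilter U) (a b : B) : a ⊓ b ∈ U ↔ a ∈ U ∧ b ∈ U :=
  ⟨fun h => ⟨hU.1.2.2.1 _ _ h inf_le_left, hU.1.2.2.1 _ _ h inf_le_right⟩,
    fun h => hU.1.2.2.2 _ _ h.1 h.2⟩

theorem ultra_finset_inf {U : Set B} (hU : IsBUltrafilter U) {ι : Type} (s : Finset ι) (f : ι → B)
    (h : ∀ i ∈ s, f i ∈ U) : s.inf f ∈ U := by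
  classical
  induction s using Finset.induction_on with
  | empty => simpa using hU.1.1
  | insert a s _ ih =>
    rw [Finset.inf_insert]
    exact hU.1.2.2.2 _ _ (h a (by simp)) (ih fun i hi => h i (by simp [hi]))

theorem ultra_congr {U : Set B} (hU : IsBUltrafilter U) {C : Type} {v : L.Formula C → B}
    (hv : IsPre v) {n : ℕ} (φ : L.Formula (Fin n)) (f g : Fin n → C)
    (h : ∀ i, v (Term.equal (Term.var (f i)) (Term.var (g i))) ∈ U)
    (hf : v (φ.relabel f) ∈ U) : v (φ.relabel g) ∈ U := by
  have h1 := ultra_finset_inf hU Finset.univ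
    (fun i => v (Term.equal (Term.var (f i)) (Term.var (g i)))) (fun i _ => h i)
  have h2 := hv.le_listConj (Finset.univ.inf
    (fun i => v (Term.equal (Term.var (f i)) (Term.var (g i)))))
    ((List.finRange n).map fun i => Term.equal (Term.var (f i)) (Term.var (g i))) (by
      intro ψ hψ
      rw [List.mem_map] at hψ
      obtain ⟨i, -, rfl⟩ := hψ
      exact Finset.inf_le (f := fun i => v (Term.equal (Term.var (f i)) (Term.var (g i))))
        (Finset.mem_univ i))
  have h3 := hU.1.2.2.2 _ _ hf (hU.1.2.2.1 _ _ h1 h2)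
  rw [← hv.2.2] at h3
  refine hU.1.2.2.1 _ _ h3 (hv.mono ?_)
  intro N _ _ u hu
  simp only [Formula.Realize, BoundedFormula.realize_inf] at hu
  obtain ⟨hu1, hu2⟩ := hu
  rw [realize_listConj] at hu2
  change (φ.relabel f).Realize u at hu1
  rw [Formula.realize_relabel] at hu1 ⊢
  have : u ∘ g = u ∘ f := by
    funext i
    have := hu2 (Term.equal (Term.var (f i)) (Term.var (g i)))
      (List.mem_map.2 ⟨i, List.mem_finRange i, rfl⟩)
    have h' : Formula.Realize (Term.equal (Term.var (f i)) (Term.var (g i)) : L.Formula C) u := this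
    simp at h'
    exact h'.symm
  rw [this]
  exact hu1

theorem exists_spec [L.IsRelational] {U : Set B} (hU : IsBUltrafilter U) {C : Type}
    {v : L.Formula C → B} (hb : IsBVal v) (hf : IsFull v) :
    ∃ (N : Type) (_ : L.Structure N) (π : C → N), IsSpecialization v U N π := by
  classical
  have hv := IsPre.of_bval hb
  let S : Setoid C := ⟨fun a b => v (Term.equal (Term.var a) (Term.var b)) ∈ U, by
    constructor
    · intro a
      rw [hv.1 _ (fun N _ _ u => by simp)]
      exact hU.1.1
    · intro a b h
      rwa [hv.congr (ψ := Term.equal (Term.var a) (Term.var b))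
        (fun N _ _ u => by simp [eq_comm])]
    · intro a b c h1 h2
      refine hU.1.2.2.1 _ _ (hU.1.2.2.2 _ _ h1 h2) ?_
      rw [← hv.2.2]
      apply hv.mono
      intro N _ _ u hu
      have hu' : (Formula.Realize (Term.equal (Term.var a) (Term.var b) : L.Formula C) u) ∧
        (Formula.Realize (Term.equal (Term.var b) (Term.var c) : L.Formula C) u) := by
          simpa only [Formula.Realize, BoundedFormula.realize_inf] using hu
      simp at hu' ⊢
      exact hu'.1.trans hu'.2⟩
  let N := Quotient S
  let π : C → N := Quotient.mk S
  have hπ : ∀ a b, π a = π b ↔ v (Term.equal (Term.var a) (Term.var b)) ∈ U := fun a b => Quotient.eq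
  let str : L.Structure N := ⟨fun f => isEmptyElim f,
    fun {n} R xs => v ((R.formula (fun i : Fin n => Term.var i)).relabel (fun i => (xs i).out)) ∈ U⟩
  have hterm : ∀ {n : ℕ} (t : L.Term (C ⊕ Fin n)) (xs : Fin n → C), ∃ c : C,
      ∀ (M : Type) [L.Structure M] (u : C → M), t.realize (Sum.elim u (u ∘ xs)) = u c := by
    intro n t xs
    cases t with
    | var s =>
      refine ⟨Sum.elim id xs s, fun M _ u => ?_⟩
      cases s <;> rfl
    | func f _ => exact isEmptyElim f
  have key : ∀ {n : ℕ} (φ : L.BoundedFormula C n) (xs : Fin n → C),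
      v (plug φ xs) ∈ U ↔ φ.Realize π (π ∘ xs) := by
    intro n φ
    induction φ with
    | falsum =>
      intro xs
      rw [hv.bot (fun M _ _ u => by rw [realize_plug]; exact id)]
      exact ⟨fun h => hU.1.2.1 h, fun h => h.elim⟩
    | equal t₁ t₂ =>
      intro xs
      obtain ⟨c1, h1⟩ := hterm t₁ xs
      obtain ⟨c2, h2⟩ := hterm t₂ xs
      have e : v (plug (BoundedFormula.equal t₁ t₂) xs) = v (Term.equal (Term.var c1) (Term.var c2)) := by
        apply hv.congr
        intro M _ _ u
        rw [realize_plug]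
        change t₁.realize _ = t₂.realize _ ↔ _
        rw [h1, h2]
        simp
      rw [e, ← hπ]
      change _ ↔ t₁.realize _ = t₂.realize _
      rw [h1, h2]
    | @rel n k R ts =>
      intro xs
      choose c hc using fun i => hterm (ts i) xs
      have e : v (plug (BoundedFormula.rel R ts) xs) =
          v ((R.formula (fun i : Fin k => Term.var i)).relabel c) := by
        apply hv.congr
        intro M _ _ u
        rw [realize_plug, Formula.realize_relabel, Formula.realize_rel]
        change Structure.RelMap R _ ↔ _
        simp only [hc]
        rfl
      rw [e]
      change _ ↔ Structure.RelMap R (fun i => (ts i).realize _)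
      simp only [hc]
      change _ ↔ v ((R.formula (fun i : Fin k => Term.var i)).relabel (fun i => (π (c i)).out)) ∈ U
      constructor
      · apply ultra_congr hU hv
        intro i
        rw [← hπ]
        exact (Quotient.out_eq _).symm
      · apply ultra_congr hU hv
        intro i
        rw [← hπ]
        exact (Quotient.out_eq _)
    | imp φ ψ ih1 ih2 =>
      intro xs
      have e : v (plug (φ.imp ψ) xs) = (v (plug φ xs) ⊓ (v (plug ψ xs))ᶜ)ᶜ := by
        rw [← hv.2.1, ← hv.2.2, ← hv.2.1]
        apply hv.congr
        intro M _ _ u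
        have : Formula.Realize (Formula.not (plug φ xs ⊓ Formula.not (plug ψ xs))) u ↔
          ¬ ((plug φ xs).Realize u ∧ ¬ (plug ψ xs).Realize u) := by
            simp [Formula.Realize, Formula.not]
        rw [this, realize_plug, realize_plug, realize_plug, BoundedFormula.realize_imp]
        tauto
      rw [e, ultra_compl hU, ultra_inf hU, ultra_compl hU, ih1, ih2, BoundedFormula.realize_imp]
      tauto
    | @all n φ ih =>
      intro xs
      let ψ : L.BoundedFormula C 1 := BoundedFormula.relabel (n := 1) (k := 0)
        (Sum.elim Sum.inl (Fin.snoc (fun i => Sum.inl (xs i)) (Sum.inr 0) : Fin (n+1) → C ⊕ Fin 1))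
        (Formula.not φ.toFormula)
      have hψ : ∀ (M : Type) [L.Structure M] (u : C → M) (y : M), ψ.Realize u (fun _ => y) ↔
          ¬ φ.Realize u (Fin.snoc (u ∘ xs) y) := by
        intro M _ u y
        simp only [ψ]
        rw [BoundedFormula.realize_relabel]
        have e : (Fin.natAdd 1 : Fin 0 → Fin 1) = fun i => i.elim0 := funext fun i => i.elim0
        change ¬ BoundedFormula.Realize _ _ _ ↔ _
        rw [not_iff_not]
        have : ∀ (w : C ⊕ Fin (n+1) → M) (d : Fin 0 → M), BoundedFormula.Realize (l := 0) φ.toFormula w d ↔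
            φ.Realize (w ∘ Sum.inl) (w ∘ Sum.inr) := by
          intro w d
          rw [← BoundedFormula.realize_toFormula, Formula.Realize]
          congr!
        rw [this]
        have e2 : (Sum.elim u ((fun _ : Fin (1+0) => y) ∘ Fin.castAdd 0) ∘
          (Sum.elim Sum.inl (Fin.snoc (fun i => Sum.inl (xs i)) (Sum.inr 0) : Fin (n+1) → C ⊕ Fin 1))) ∘ Sum.inr
          = Fin.snoc (u ∘ xs) y := by
          funext i
          refine Fin.lastCases ?_ (fun i => ?_) i
          · simp
          · simp
        rw [e2]
        rfl
      obtain ⟨a, ha⟩ := hf ψ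
      have e : v (plug φ.all xs) = (v ψ.ex)ᶜ := by
        rw [← hv.2.1]
        apply hv.congr
        intro M _ _ u
        rw [Formula.realize_not, realize_ex1, realize_plug, BoundedFormula.realize_all]
        simp only [hψ]
        push Not
        rfl
      have e3 : ∀ c, v (plug ψ fun _ => c) = (v (plug φ (Fin.snoc xs c)))ᶜ := by
        intro c
        rw [← hv.2.1]
        apply hv.congr
        intro M _ _ u
        rw [Formula.realize_not, realize_plug, realize_plug]
        change ψ.Realize u (fun _ => u c) ↔ _
        rw [hψ, Fin.comp_snoc]
      rw [e, ultra_compl hU, BoundedFormula.realize_all]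
      constructor
      · intro h y
        obtain ⟨c, rfl⟩ := Quotient.exists_rep y
        have := ih (Fin.snoc xs c)
        rw [Fin.comp_snoc] at this
        refine this.1 ?_
        by_contra hc
        rw [← ultra_compl hU, ← e3] at hc
        exact h (hU.1.2.2.1 _ _ hc (hv.plug_le_ex _ _))
      · intro h
        rw [ha, e3, ultra_compl hU, not_not, ih, Fin.comp_snoc]
        exact h _
  refine ⟨N, str, π, Quotient.mk_surjective, fun φ => ?_⟩
  have := key φ Fin.elim0
  rw [Formula.Realize]
  have e : v (plug φ Fin.elim0) = v φ := by
    apply hv.congr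
    intro M _ _ u
    rw [realize_plug, Formula.Realize]
    congr!
  rw [e] at this
  rw [this]
  congr!
end GU

namespace GU
variable {B : Type} [CompleteBooleanAlgebra B]

/-- The formula: `x` is nonzero and `x ≤ c`. -/
def gam {C : Type} (c : C) : FirstOrder.Language.order.BoundedFormula C 1 :=
  (BoundedFormula.ex (BoundedFormula.not (BoundedFormula.rel (n := 2) orderRel.le
    ![Term.var (Sum.inr 0), Term.var (Sum.inr 1)]))) ⊓
  BoundedFormula.rel (n := 1) orderRel.le ![Term.var (Sum.inr 0), Term.var (Sum.inl c)]

/-- Semantic content of `gam`. -/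
def Bel {N : Type} [FirstOrder.Language.order.Structure N] (x y : N) : Prop :=
  (∃ z : N, ¬ Structure.RelMap (L := FirstOrder.Language.order) orderRel.le ![x, z]) ∧
    Structure.RelMap (L := FirstOrder.Language.order) orderRel.le ![x, y]

theorem realize_gam {C N : Type} [FirstOrder.Language.order.Structure N] (c : C) (u : C → N)
    (x : N) : (gam c).Realize u (fun _ => x) ↔ Bel x (u c) := by
  rw [gam, BoundedFormula.realize_inf, BoundedFormula.realize_ex, Bel]
  have h2 : ∀ (n : ℕ) (t : Fin 2 → FirstOrder.Language.order.Term (C ⊕ Fin n)) (xs : Fin n → N),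
      (BoundedFormula.rel (L := FirstOrder.Language.order) orderRel.le t).Realize u xs ↔
      Structure.RelMap (L := FirstOrder.Language.order) orderRel.le
        ![(t 0).realize (Sum.elim u xs), (t 1).realize (Sum.elim u xs)] := by
    intro n t xs
    change Structure.RelMap (L := FirstOrder.Language.order) orderRel.le _ ↔ _
    congr! 1
    funext i
    fin_cases i <;> rfl
  simp only [BoundedFormula.realize_not, h2]
  rfl

theorem bel_finset (x y : Finset ℕ) : Bel x y ↔ x.Nonempty ∧ x ⊆ y := by
  have h : ∀ a b : Finset ℕ, Structure.RelMap (L := FirstOrder.Language.order) orderRel.le ![a, b] ↔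
      a ⊆ b := fun a b => Iff.rfl
  simp only [Bel, h]
  refine and_congr_left fun _ => ?_
  constructor
  · rintro ⟨z, hz⟩
    rw [Finset.nonempty_iff_ne_empty]
    rintro rfl
    exact hz (Finset.empty_subset _)
  · rintro ⟨n, hn⟩
    exact ⟨∅, fun h => by simpa using h hn⟩

/-- `∃ x, ⋀_{i ∈ s} (x ≠ 0 ∧ x ≤ a_i)` -/
noncomputable def FF {I : Type} (s : Finset I) : FirstOrder.Language.order.Formula I :=
  (listConj (s.toList.map gam)).ex

theorem realize_FF {I N : Type} [FirstOrder.Language.order.Structure N] (s : Finset I) (u : I → N) :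
    (FF s).Realize u ↔ ∃ x, ∀ i ∈ s, Bel x (u i) := by
  rw [FF, realize_ex1]
  simp [realize_listConj, realize_gam]

theorem exists_pre {I : Type} (A : Finset I → B) (hA : IsDistribution A) :
    ∃ v : FirstOrder.Language.order.Formula I → B, IsPre v ∧
      (∀ φ : FirstOrder.Language.order.Sentence, Finset ℕ ⊨ φ →
        v (φ.relabel (fun e : Empty => e.elim)) = ⊤) ∧
      ∀ s, v (FF s) = A s := by
  classical
  let E : Finset I → Set (I → Finset ℕ) := fun s => {u | (FF s).Realize u}
  obtain ⟨v, hv, hR⟩ := ext_lemma (B := B) (L := FirstOrder.Language.order) (X := I → Finset ℕ) (C := I)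
    (fun _ => Finset ℕ) (fun u => u)
    {p | ∃ P Q : Finset (Finset I), p =
      ({u | (∀ s ∈ P, u ∈ E s) ∧ ∀ t ∈ Q, u ∉ E t}, P.inf A ⊓ Q.inf fun t => (A t)ᶜ)}
    ⟨∅, ∅, by simp⟩ (by
      rintro _ ⟨P1, Q1, rfl⟩ _ ⟨P2, Q2, rfl⟩
      refine ⟨P1 ∪ P2, Q1 ∪ Q2, Prod.ext ?_ ?_⟩
      · ext u
        simp only [Set.mem_inter_iff, Set.mem_setOf_eq, Finset.mem_union]
        constructor
        · rintro ⟨⟨a, b⟩, c, d⟩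
          exact ⟨fun s hs => hs.elim (a s) (c s), fun s hs => hs.elim (b s) (d s)⟩
        · rintro ⟨a, b⟩
          exact ⟨⟨fun s hs => a s (Or.inl hs), fun s hs => b s (Or.inl hs)⟩,
            fun s hs => a s (Or.inr hs), fun s hs => b s (Or.inr hs)⟩
      · simp only [Finset.inf_union]
        exact inf_inf_inf_comm _ _ _ _) (by
      rintro _ ⟨P, Q, rfl⟩ h
      by_contra hne
      simp only at hne h
      let k : P → ℕ := fun s => (P.equivFin s : ℕ)
      have hk : Function.Injective k := fun a b hab => P.equivFin.injective (Fin.ext hab)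
      let u : I → Finset ℕ := fun α => (P.attach.filter fun s => α ∈ s.1).image k
      have hu : u ∈ (∅ : Set (I → Finset ℕ)) := by
        rw [← h]
        refine ⟨fun s hs => ?_, fun t ht hu => ?_⟩
        · change (FF s).Realize u
          rw [realize_FF]
          refine ⟨{k ⟨s, hs⟩}, fun i hi => ?_⟩
          rw [bel_finset]
          refine ⟨by simp, ?_⟩
          rw [Finset.singleton_subset_iff]
          exact Finset.mem_image_of_mem _ (by simpa using hi)
        · change (FF t).Realize u at hu
          rw [realize_FF] at hu
          obtain ⟨x, hx⟩ := hu
          apply hne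
          have hQ : Q.inf (fun t => (A t)ᶜ) ≤ (A t)ᶜ :=
            Finset.inf_le (f := fun t => (A t)ᶜ) ht
          rcases t.eq_empty_or_nonempty with rfl | ⟨α, hα⟩
          · rw [hA.1, compl_top] at hQ
            rw [le_bot_iff.1 hQ, inf_bot_eq]
          · obtain ⟨⟨n, hn⟩, hxα⟩ := (bel_finset _ _).1 (hx α hα)
            obtain ⟨s, -, rfl⟩ := Finset.mem_image.1 (hxα hn)
            have hts : t ⊆ s.1 := by
              intro β hβ
              have := ((bel_finset _ _).1 (hx β hβ)).2 hn
              obtain ⟨s', hs', hss⟩ := Finset.mem_image.1 this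
              rw [hk hss] at hs'
              simpa using hs'
            have hP : P.inf A ≤ A t := (Finset.inf_le s.2).trans (hA.2.2 _ _ hts)
            exact le_bot_iff.1 ((inf_le_inf hP hQ).trans (le_of_eq inf_compl_eq_bot))
      exact hu)
  refine ⟨v, hv, ?_, ?_⟩
  · intro φ hφ
    rw [eq_top_iff]
    refine le_trans (le_of_eq ?_) (hR _ ⟨∅, ∅, rfl⟩ _ ?_)
    · simp
    · intro x _
      rw [Formula.realize_relabel]
      rw [Sentence.Realize] at hφ
      convert hφ
  · intro s
    apply le_antisymm
    · have := hR _ ⟨∅, {s}, rfl⟩ (FF s).not (by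
        intro x hx
        rw [Formula.realize_not]
        exact hx.2 s (by simp))
      rw [hv.2.1] at this
      simpa using this
    · have := hR _ ⟨{s}, ∅, rfl⟩ (FF s) (by
        intro x hx
        exact hx.1 s (by simp))
      simpa using this

theorem good_of_saturates {lam : Cardinal.{0}} (hlam : ℵ₀ ≤ lam) {U : Set B}
    (hU : IsBUltrafilter U)
    (hs : Saturates U (FirstOrder.Language.completeTheory
          FirstOrder.Language.order (Finset ℕ)) lam) : IsGoodFilter U lam := by
  classical
  intro A hA hAU
  obtain ⟨v1, hv1, hT, hvA⟩ := exists_pre A hA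
  obtain ⟨M, w, hM, hsat, huniv⟩ := exists_sat (B := B) (L := FirstOrder.Language.order) (Finset ℕ) hlam
    (by rw [order.card_eq_one]; exact Cardinal.one_le_aleph0)
  obtain ⟨g, hg⟩ := huniv v1 hv1 hT
  obtain ⟨N, str, π, hπ⟩ := exists_spec hU hM.1 hM.2.1
  have hw := IsPre.of_bval hM.1
  have hos := hs M w hM hsat N π hπ
  let e : Quotient.out lam → Set.range (π ∘ g) := fun i => ⟨π (g i), i, rfl⟩
  obtain ⟨b, hb⟩ := hos (Set.range (π ∘ g))
    (Cardinal.mk_range_le.trans (Cardinal.mk_out lam).le) (Set.range fun i => gam (e i)) (by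
      intro s hsub
      haveI : Nonempty (Quotient.out lam) := by
        rw [← Cardinal.mk_ne_zero_iff, Cardinal.mk_out]
        exact (lt_of_lt_of_le Cardinal.aleph0_pos hlam).ne'
      choose! ix hix using hsub
      have hmem : w ((FF (s.image ix)).relabel g) ∈ U := by
        rw [hg, hvA]; exact hAU _
      rw [hπ.2, Formula.realize_relabel, realize_FF] at hmem
      obtain ⟨x, hx⟩ := hmem
      refine ⟨x, fun φ hφ => ?_⟩
      rw [← hix hφ, realize_gam]
      exact hx _ (Finset.mem_image_of_mem _ hφ))
  obtain ⟨c, rfl⟩ := hπ.1 b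
  have hin : ∀ i, w (plug (gam (g i)) fun _ => c) ∈ U := by
    intro i
    rw [hπ.2, realize_plug]
    have := hb _ ⟨i, rfl⟩
    simp only [realize_gam] at this
    exact (realize_gam _ _ _).2 this
  have hinf : ∀ s : Finset (Quotient.out lam),
      s.inf (fun i => w (plug (gam (g i)) fun _ => c)) ∈ U :=
    fun s => ultra_finset_inf hU s _ fun i _ => hin i
  refine ⟨fun s => s.inf fun i => w (plug (gam (g i)) fun _ => c), ⟨?_, ?_, ?_⟩, ?_, hinf, ?_⟩
  · simp
  · intro s h
    exact hU.1.2.1 (h ▸ hinf s)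
  · intro s t hst
    exact Finset.inf_mono hst
  · intro s
    simp
  · intro s
    rw [← hvA, ← hg]
    refine (hw.le_listConj _ (s.toList.map fun i => plug (gam (g i)) fun _ => c) ?_).trans (hw.mono ?_)
    · intro φ hφ
      obtain ⟨i, hi, rfl⟩ := List.mem_map.1 hφ
      exact Finset.inf_le (f := fun i => w (plug (gam (g i)) fun _ => c)) (Finset.mem_toList.1 hi)
    · intro N' _ _ u hu
      rw [Formula.Realize, realize_listConj] at hu
      rw [Formula.realize_relabel, realize_FF]
      refine ⟨u c, fun i hi => ?_⟩
      have : (plug (gam (g i)) fun _ => c).Realize u :=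
        hu _ (List.mem_map.2 ⟨i, Finset.mem_toList.2 hi, rfl⟩)
      rw [realize_plug] at this
      exact (realize_gam (g i) u (u c)).1 this

end GU

/-- **Characterization of `λ⁺`-good ultrafilters** (Theorem 6.3). -/
theorem stmt10_good_ultrafilters (B : Type) [CompleteBooleanAlgebra B]
    (lam : Cardinal) (hlam : ℵ₀ ≤ lam) (U : Set B) (hU : IsBUltrafilter U) :
    List.TFAE
      [IsGoodFilter U lam,
        ∀ (L : FirstOrder.Language.{0, 0}), L.card ≤ ℵ₀ →
          ∀ T : L.Theory, T.IsComplete → Saturates U T lam,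
        Saturates U (FirstOrder.Language.completeTheory
          FirstOrder.Language.order (Finset ℕ)) lam] := by
  tfae_have 1 → 2 := fun h L hL T _ => GU.good_saturates hlam hU h hL T
  tfae_have 2 → 3 := fun h => h _ (by rw [order.card_eq_one]; exact Cardinal.one_le_aleph0) _
    (completeTheory.isComplete _ _)
  tfae_have 3 → 1 := fun h => GU.good_of_saturates hlam hU h
  tfae_finish
end

section
/- Suppose λ is an infinite cardinal and B is a complete Boolean algebra. Then B admits a λ-regular family (a_α : α < λ) if and only if B has an antichain of cardinality λ. -/
open FirstOrder FirstOrder.Language Cardinal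

open BVal

namespace BVal

theorem regular_of_antichain {B I : Type} [CompleteBooleanAlgebra B] (c : Finset I → B)
    (hc : ∀ s, c s ≠ ⊥) (hd : ∀ s t, s ≠ t → c s ⊓ c t = ⊥) :
    IsRegularFamily (fun i : I => ⨆ s : {s : Finset I // i ∈ s}, c s.1) := by
  have key : ∀ (i : I) (s : Finset I), i ∉ s → c s ⊓ (⨆ s : {s : Finset I // i ∈ s}, c s.1) = ⊥ := by
    intro i s his
    rw [inf_iSup_eq, iSup_eq_bot]
    rintro ⟨t, ht⟩
    exact hd s t (fun h => his (h ▸ ht))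
  refine ⟨⟨?_, ?_⟩, ?_⟩
  · intro s h
    refine hc s (le_bot_iff.1 (h ▸ Finset.le_inf fun i hi => ?_))
    exact le_iSup (fun t : {t : Finset I // i ∈ t} => c t.1) ⟨s, hi⟩
  · intro J _ hJ
    obtain ⟨i0, hi0⟩ := hJ.nonempty
    have h1 : (⨅ i ∈ J, ⨆ s : {s : Finset I // i ∈ s}, c s.1)
        ≤ ⨆ s : {s : Finset I // i0 ∈ s}, c s.1 := iInf₂_le i0 hi0
    rw [← inf_eq_left.2 h1, inf_iSup_eq, iSup_eq_bot]
    rintro ⟨s, _⟩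
    obtain ⟨j, hj, hjs⟩ := hJ.exists_notMem_finset s
    rw [← le_bot_iff, ← key j s hjs]
    exact le_inf inf_le_right (inf_le_left.trans (iInf₂_le j hj))
  · intro b hb
    by_cases h : ∃ s, b ⊓ c s ≠ ⊥
    · obtain ⟨s, hs⟩ := h
      refine ⟨b ⊓ c s, hs, inf_le_left, fun i => ?_⟩
      by_cases his : i ∈ s
      · left
        exact inf_le_right.trans (le_iSup (fun t : {t : Finset I // i ∈ t} => c t.1) ⟨s, his⟩)
      · right
        exact inf_le_right.trans (le_compl_iff_disjoint_right.2 (disjoint_iff.2 (key i s his)))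
    · push Not at h
      refine ⟨b, hb, le_rfl, fun i => Or.inr ?_⟩
      rw [le_compl_iff_disjoint_right, disjoint_iff, inf_iSup_eq, iSup_eq_bot]
      exact fun s => h s.1

theorem antichain_of_regular {B I : Type} [CompleteBooleanAlgebra B] [Infinite I] (a : I → B)
    (ha : IsRegularFamily a) : ∃ S : Set B, IsBAntichain S ∧ Cardinal.mk ↥S = Cardinal.mk I := by
  classical
  obtain ⟨⟨hfin, hinf⟩, hdec⟩ := ha
  let c : Finset I → B := fun s => ⨅ i, if i ∈ s then a i else (a i)ᶜ
  have hd : ∀ s t, s ≠ t → c s ⊓ c t = ⊥ := by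
    have aux : ∀ s t : Finset I, ∀ i, i ∈ s → i ∉ t → c s ⊓ c t = ⊥ := by
      intro s t i his hit
      have h1 : c s ≤ a i := by simpa [his] using
        (iInf_le (fun i => if i ∈ s then a i else (a i)ᶜ) i)
      have h2 : c t ≤ (a i)ᶜ := by simpa [hit] using
        (iInf_le (fun i => if i ∈ t then a i else (a i)ᶜ) i)
      rw [← le_bot_iff, ← inf_compl_eq_bot (a := a i)]
      exact inf_le_inf h1 h2
    intro s t hst
    by_contra hne
    refine hst (Finset.ext fun i => ⟨fun hi => ?_, fun hi => ?_⟩)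
    · by_contra hit
      exact hne (aux s t i hi hit)
    · by_contra hit
      exact hne (inf_comm (c s) (c t) ▸ aux t s i hi hit)
  let T : Set (Finset I) := {s | c s ≠ ⊥}
  have hcov : ∀ i : I, ∃ s : T, i ∈ s.1 := by
    intro i
    have hi : a i ≠ ⊥ := by simpa using hfin {i}
    obtain ⟨b, hb, hbi, hbd⟩ := hdec (a i) hi
    have hF : {j | b ≤ a j}.Finite := by
      by_contra hF
      obtain ⟨J, hJs, hJi, hJc⟩ : ∃ J ⊆ {j | b ≤ a j}, J.Infinite ∧ J.Countable := by
        have hF' : {j | b ≤ a j}.Infinite := hF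
        let e := hF'.natEmbedding
        refine ⟨Set.range fun n => (e n).1, ?_, ?_, Set.countable_range _⟩
        · rintro _ ⟨n, rfl⟩
          exact (e n).2
        · exact Set.infinite_range_of_injective (Subtype.val_injective.comp e.injective)
      refine hb (le_bot_iff.1 ?_)
      rw [← hinf J hJc hJi]
      exact le_iInf₂ fun j hj => hJs hj
    refine ⟨⟨hF.toFinset, fun h => hb (le_bot_iff.1 (h ▸ le_iInf fun j => ?_))⟩, by simpa using hbi⟩
    by_cases hj : b ≤ a j
    · simp [hj]
    · simpa [hj] using (hbd j).resolve_left hj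
  choose f hf using hcov
  let g : I → Σ t : T, {i // i ∈ t.1} := fun i => ⟨f i, i, hf i⟩
  have hg : Function.Injective g := by
    intro i j hij
    exact congrArg (fun p : Σ t : T, {i // i ∈ t.1} => p.2.1) hij
  have hTi : Infinite T := by
    by_contra h
    rw [not_infinite_iff_finite] at h
    have := Finite.of_injective g hg
    exact not_finite I
  have hle : Cardinal.mk I ≤ Cardinal.mk T := by
    have h1 := Cardinal.mk_le_of_injective hg
    rw [Cardinal.mk_sigma] at h1
    refine h1.trans ((Cardinal.sum_le_sum _ (fun _ => ℵ₀) fun t => ?_).trans ?_)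
    · exact Cardinal.mk_le_aleph0
    · rw [Cardinal.sum_const']
      exact (Cardinal.mul_aleph0_eq (Cardinal.aleph0_le_mk T)).le
  have hinj : Set.InjOn c T := by
    intro s hs t _ hst
    by_contra hne
    have := hd s t hne
    rw [← hst, inf_idem] at this
    exact hs this
  have hle2 : Cardinal.mk I ≤ Cardinal.mk (c '' T) := by
    rwa [Cardinal.mk_image_eq_of_injOn _ _ hinj]
  obtain ⟨S, hS, hSc⟩ := Cardinal.le_mk_iff_exists_subset.1 hle2
  refine ⟨S, ⟨?_, ?_⟩, hSc⟩
  · intro x hx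
    obtain ⟨s, hs, rfl⟩ := hS hx
    exact hs
  · intro x hx y hy hxy
    obtain ⟨s, hs, rfl⟩ := hS hx
    obtain ⟨t, ht, rfl⟩ := hS hy
    exact hd s t fun h => hxy (h ▸ rfl)

end BVal

/-- **A complete Boolean algebra admits a `λ`-regular sequence iff it has an antichain
of size `λ`** (Theorem 5.7). -/
theorem stmt11_regular_iff_antichain (B : Type) [CompleteBooleanAlgebra B]
    (lam : Cardinal) (hlam : ℵ₀ ≤ lam) :
    (∃ a : Quotient.out lam → B, IsRegularFamily a) ↔
      ∃ S : Set B, IsBAntichain S ∧ Cardinal.mk ↥S = lam := by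
  have : Infinite (Quotient.out lam) := by
    rw [Cardinal.infinite_iff, Cardinal.mk_out]
    exact hlam
  constructor
  · rintro ⟨a, ha⟩
    obtain ⟨S, hS, hc⟩ := antichain_of_regular a ha
    exact ⟨S, hS, hc.trans (Cardinal.mk_out lam)⟩
  · rintro ⟨S, ⟨hS0, hSd⟩, hc⟩
    have he : Cardinal.mk (Finset (Quotient.out lam)) = Cardinal.mk S := by
      rw [Cardinal.mk_finset_of_infinite, Cardinal.mk_out, hc]
    obtain ⟨e⟩ := Cardinal.eq.1 he
    refine ⟨_, regular_of_antichain (fun s => (e s).1) (fun s => hS0 _ (e s).2) ?_⟩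
    intro s t hst
    exact hSd (e s).2 (e t).2 fun h => hst (e.injective (Subtype.ext h))
end

section
/- Suppose B is a complete Boolean algebra. Then: (I) if (a_i : i ∈ I) is an I-regular family, b_i ≤ a_i for each i ∈ I, and the family (b_i : i ∈ I) has the finite intersection property (every finite meet of its members is nonzero), then (b_i : i ∈ I) is I-regular; (II) every refinement of an I-regular I-distribution is I-regular; (III) if A is an I-regular I-distribution, then the family (A(s) : s a finite subset of I), indexed by the finite subsets of I, is regular (with respect to that index set); (IV) if λ is an infinite cardinal and U is a λ-regular ultrafilter on B, then every λ-distribution in U has a conservative refinement in U that is λ-regular. -/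
open FirstOrder FirstOrder.Language Cardinal

open BVal

/-- If `b ≠ ⊥` is disjoint from all but finitely many members of a family, it can be shrunk to
decide the whole family. -/
theorem exists_decides {B : Type} [CompleteBooleanAlgebra B] {K : Type} (c : K → B)
    (s : Finset K) : ∀ b : B, b ≠ ⊥ → (∀ k, k ∉ s → b ≤ (c k)ᶜ) →
      ∃ b' : B, b' ≠ ⊥ ∧ b' ≤ b ∧ ∀ k, b' ≤ c k ∨ b' ≤ (c k)ᶜ := by
  classical
  intro b hb hs
  have key : ∀ t : Finset K, ∃ b' : B, b' ≠ ⊥ ∧ b' ≤ b ∧ ∀ k ∈ t, b' ≤ c k ∨ b' ≤ (c k)ᶜ := by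
    intro t
    induction t using Finset.induction_on with
    | empty => exact ⟨b, hb, le_rfl, by simp⟩
    | insert k t _ ih =>
      obtain ⟨d, hd, hdb, hdt⟩ := ih
      by_cases h : d ⊓ c k = ⊥
      · refine ⟨d, hd, hdb, fun j hj => ?_⟩
        rcases Finset.mem_insert.1 hj with rfl | hj
        · exact Or.inr (le_compl_iff_disjoint_right.2 (disjoint_iff.2 h))
        · exact hdt j hj
      · refine ⟨d ⊓ c k, h, inf_le_left.trans hdb, fun j hj => ?_⟩
        rcases Finset.mem_insert.1 hj with rfl | hj
        · exact Or.inl inf_le_right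
        · exact (hdt j hj).imp inf_le_left.trans inf_le_left.trans
  obtain ⟨b', h1, h2, h3⟩ := key s
  refine ⟨b', h1, h2, fun k => ?_⟩
  by_cases hk : k ∈ s
  · exact h3 k hk
  · exact Or.inr (h2.trans (hs k hk))

/-- A nonzero element lies below only finitely many members of a quasiregular family. -/
theorem finite_below {B : Type} [CompleteBooleanAlgebra B] {I : Type} {a : I → B}
    (ha : IsQuasiregularFamily a) {b : B} (hb : b ≠ ⊥) : {i | b ≤ a i}.Finite := by
  by_contra h
  have h : {i | b ≤ a i}.Infinite := h
  let f := h.natEmbedding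
  have hinj : Function.Injective fun n => (f n : I) :=
    Subtype.val_injective.comp f.injective
  apply hb
  rw [← le_bot_iff, ← ha.2 (Set.range fun n => (f n : I)) (Set.countable_range _)
    (Set.infinite_range_of_injective hinj)]
  refine le_iInf₂ fun i hi => ?_
  obtain ⟨n, rfl⟩ := hi
  exact (f n).2

theorem regular_of_le {B : Type} [CompleteBooleanAlgebra B] (I : Type) (a b : I → B)
    (ha : IsRegularFamily a) (hba : ∀ i, b i ≤ a i)
    (hb : ∀ s : Finset I, s.inf b ≠ ⊥) : IsRegularFamily b := by
  refine ⟨⟨hb, fun J hJ hJi => ?_⟩, fun d hd => ?_⟩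
  · rw [← le_bot_iff, ← ha.1.2 J hJ hJi]
    exact iInf₂_mono fun i _ => hba i
  · obtain ⟨e, he, hed, hdec⟩ := ha.2 d hd
    have hf := finite_below ha.1 he
    obtain ⟨g, hg, hge, hgd⟩ := exists_decides b hf.toFinset e he (fun k hk => by
      have hk : ¬ e ≤ a k := by simpa using hk
      exact ((hdec k).resolve_left hk).trans (compl_le_compl (hba k)))
    exact ⟨g, hg, hge.trans hed, hgd⟩

theorem regular_finsets {B : Type} [CompleteBooleanAlgebra B] (I : Type) (A : Finset I → B)
    (hA : IsDistribution A) (hr : IsRegularDistribution A) :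
    IsRegularFamily fun s : Finset I => A s := by
  classical
  obtain ⟨_, h0, hm⟩ := hA
  refine ⟨⟨fun S hS => ?_, fun J hJ hJi => ?_⟩, fun d hd => ?_⟩
  · apply h0 (S.sup id)
    rw [← le_bot_iff, ← hS]
    exact Finset.le_inf fun s hs => hm _ _ (Finset.le_sup (f := id) hs)
  · have hc : (⋃ s ∈ J, (s : Set I)).Countable :=
      hJ.biUnion fun s _ => s.countable_toSet
    have hi : (⋃ s ∈ J, (s : Set I)).Infinite := by
      intro hf
      apply hJi
      refine (hf.toFinset.powerset.finite_toSet).subset fun s hs => ?_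
      simp only [Finset.coe_powerset, Set.mem_preimage, Set.mem_powerset_iff,
        Set.Finite.coe_toFinset]
      exact Set.subset_biUnion_of_mem (u := fun s : Finset I => (s : Set I)) hs
    rw [← le_bot_iff, ← hr.1.2 _ hc hi]
    refine le_iInf₂ fun i hi => ?_
    obtain ⟨s, hs, his⟩ := Set.mem_iUnion₂.1 hi
    exact (iInf₂_le s hs).trans (hm _ _ (by simpa using his))
  · obtain ⟨e, he, hed, hdec⟩ := hr.2 d hd
    have hf := finite_below hr.1 he
    obtain ⟨g, hg, hge, hgd⟩ := exists_decides A hf.toFinset.powerset e he (fun s hs => by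
      have hs : ¬ s ⊆ hf.toFinset := by simpa using hs
      obtain ⟨i, his, hi⟩ := Finset.not_subset.1 hs
      have hk : ¬ e ≤ A {i} := by simpa using hi
      exact ((hdec i).resolve_left hk).trans
        (compl_le_compl (hm _ _ (by simpa using his))))
    exact ⟨g, hg, hge.trans hed, hgd⟩

theorem filter_finset_inf {B : Type} [CompleteBooleanAlgebra B] {U : Set B} (hU : IsBFilter U)
    {I : Type} (f : I → B) (s : Finset I) (h : ∀ i ∈ s, f i ∈ U) : s.inf f ∈ U := by
  classical
  induction s using Finset.induction_on with
  | empty => simpa using hU.1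
  | insert k t _ ih =>
    rw [Finset.inf_insert]
    exact hU.2.2.2 _ _ (h k (Finset.mem_insert_self _ _))
      (ih fun i hi => h i (Finset.mem_insert_of_mem hi))

/-- **Hereditary properties of regularity** (Lemma 5.8). -/
theorem stmt12_regularity_hereditary (B : Type) [CompleteBooleanAlgebra B] :
    -- (I)
    (∀ (I : Type) (a b : I → B), IsRegularFamily a → (∀ i, b i ≤ a i) →
      (∀ s : Finset I, s.inf b ≠ ⊥) → IsRegularFamily b) ∧
    -- (II)
    (∀ (I : Type) (A A' : Finset I → B), IsDistribution A → IsRegularDistribution A →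
      IsDistribution A' → Refines A' A → IsRegularDistribution A') ∧
    -- (III)
    (∀ (I : Type) (A : Finset I → B), IsDistribution A → IsRegularDistribution A →
      IsRegularFamily fun s : Finset I => A s) ∧
    -- (IV)
    (∀ lam : Cardinal, ℵ₀ ≤ lam → ∀ U : Set B, IsBUltrafilter U →
      IsRegularFilter U lam →
      ∀ A : Finset (Quotient.out lam) → B, IsDistribution A → InFilter A U →
        ∃ A' : Finset (Quotient.out lam) → B, IsDistribution A' ∧ ConsRefines A' A ∧
          InFilter A' U ∧ IsRegularDistribution A') := by
  refine ⟨regular_of_le, ?_, regular_finsets, ?_⟩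
  · intro I A A' _ hr hA' href
    refine regular_of_le I _ _ hr (fun i => href {i}) fun s hs => hA'.2.1 s ?_
    rw [← le_bot_iff, ← hs]
    exact Finset.le_inf fun i hi => hA'.2.2 _ _ (by simpa using hi)
  · intro lam _ U hU hreg A hA hAU
    obtain ⟨a, ha, haU⟩ := hreg
    have hUne : ∀ x ∈ U, x ≠ ⊥ := fun x hx h => hU.1.2.1 (h ▸ hx)
    have hin : ∀ s : Finset (Quotient.out lam), A s ⊓ s.inf a ∈ U := fun s =>
      hU.1.2.2.2 _ _ (hAU s) (filter_finset_inf hU.1 a s fun i _ => haU i)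
    refine ⟨fun s => A s ⊓ s.inf a, ⟨by simp [hA.1], fun s => hUne _ (hin s), ?_⟩, ?_, hin, ?_⟩
    · exact fun s t hst => inf_le_inf (hA.2.2 s t hst) (Finset.inf_mono hst)
    · intro s
      apply le_antisymm
      · refine le_inf inf_le_left (Finset.le_inf fun i hi => ?_)
        exact inf_le_inf (hA.2.2 _ _ (by simpa using hi)) (Finset.inf_mono (by simpa using hi))
      · refine inf_le_inf le_rfl (Finset.le_inf fun i hi => ?_)
        refine (Finset.inf_le hi).trans ?_
        simp
    · refine regular_of_le _ a _ ha (fun i => by simp) fun s => hUne _ ?_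
      exact filter_finset_inf hU.1 _ s fun i _ => hin {i}
end

section
/- Suppose B0 and B1 are complete Boolean algebras, j : B0 → B1 is a surjective Boolean algebra homomorphism, λ is an infinite cardinal, and the filter D = j⁻¹({1}) on B0 is λ⁺-good. Suppose U1 is an ultrafilter on B1 and U0 = j⁻¹(U1) (an ultrafilter on B0 extending D). Then for every λ-distribution A0 in U0: A0 has a multiplicative refinement in U0 if and only if the λ-distribution j ∘ A0 has a multiplicative refinement in U1. -/
open FirstOrder FirstOrder.Language Cardinal

open BVal

/-- **Multiplicative refinements transfer along surjective homomorphisms with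
`λ⁺`-good kernel filter** (Lemmas 8.2 and 8.3). -/
theorem stmt13_sep_of_vars_distributions (B0 B1 : Type)
    [CompleteBooleanAlgebra B0] [CompleteBooleanAlgebra B1]
    (j : B0 → B1) (hsurj : Function.Surjective j)
    (hbot : j ⊥ = ⊥) (htop : j ⊤ = ⊤)
    (hinf : ∀ a b : B0, j (a ⊓ b) = j a ⊓ j b)
    (hsup : ∀ a b : B0, j (a ⊔ b) = j a ⊔ j b)
    (hcompl : ∀ a : B0, j aᶜ = (j a)ᶜ)
    (lam : Cardinal) (hlam : ℵ₀ ≤ lam) (hgood : IsGoodFilter (j ⁻¹' {⊤}) lam)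
    (U1 : Set B1) (hU1 : IsBUltrafilter U1)
    (A0 : Finset (Quotient.out lam) → B0) (hA0 : IsDistribution A0)
    (hA0U : InFilter A0 (j ⁻¹' U1)) :
    HasMultRefinement A0 (j ⁻¹' U1) ↔ HasMultRefinement (fun s => j (A0 s)) U1 := by
  obtain ⟨⟨hUtop, hUbot, hUup, hUinf⟩, -⟩ := hU1
  have hmono : ∀ a b : B0, a ≤ b → j a ≤ j b := by
    intro a b h
    have := hinf a b
    rw [inf_eq_left.mpr h] at this
    exact inf_eq_left.mp this.symm
  have hfin : ∀ (J : Type) (s : Finset J) (f : J → B0),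
      j (s.inf f) = s.inf fun i => j (f i) := by
    classical
    intro J s f
    induction s using Finset.induction_on with
    | empty => simpa using htop
    | insert a s ha ih => rw [Finset.inf_insert, Finset.inf_insert, hinf, ih]
  have hne : ∀ b : B0, j b ∈ U1 → b ≠ ⊥ := by
    rintro b hb rfl
    exact hUbot (hbot ▸ hb)
  constructor
  · rintro ⟨A, ⟨h1, h2, h3⟩, hm, hU, hr⟩
    refine ⟨fun s => j (A s), ⟨?_, ?_, ?_⟩, ?_, ?_, ?_⟩
    · simp only [h1, htop]
    · intro s hs
      exact hUbot (hs ▸ hU s)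
    · intro s t hst
      exact hmono _ _ (h3 s t hst)
    · intro s
      change j (A s) = s.inf fun i => j (A {i})
      rw [hm s, hfin]
    · exact fun s => hU s
    · exact fun s => hmono _ _ (hr s)
  · rintro ⟨A1, ⟨h1, h2, h3⟩, hm, hU, hr⟩
    choose b hb using fun i => hsurj (A1 {i})
    have hbs : ∀ s : Finset (Quotient.out lam), j (s.inf b) = A1 s := by
      intro s
      rw [hfin, hm s]
      simp only [hb]
    have hjC : ∀ s : Finset (Quotient.out lam),
        j (s.powerset.inf fun t => (t.inf b)ᶜ ⊔ A0 t) = ⊤ := by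
      intro s
      rw [hfin, Finset.inf_eq_top_iff]
      intro t _
      rw [hsup, hcompl, hbs, eq_top_iff, ← compl_sup_eq_top (x := A1 t)]
      exact sup_le_sup_left (hr t) _
    obtain ⟨C, ⟨c1, c2, c3⟩, cm, cU, cr⟩ :=
      hgood (fun s => s.powerset.inf fun t => (t.inf b)ᶜ ⊔ A0 t)
        ⟨by simp [hA0.1], fun s => hne _ (by rw [hjC]; exact hUtop),
          fun s t hst => Finset.inf_mono (Finset.powerset_mono.mpr hst)⟩
        (fun s => hjC s)
    have cU' : ∀ s, j (C s) = ⊤ := fun s => cU s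
    have hj : ∀ s : Finset (Quotient.out lam), j (s.inf fun i => b i ⊓ C {i}) = A1 s := by
      intro s
      rw [hfin, hm s]
      simp only [hinf, hb, cU', inf_top_eq]
    refine ⟨fun s => s.inf fun i => b i ⊓ C {i}, ⟨?_, ?_, ?_⟩, ?_, ?_, ?_⟩
    · simp
    · exact fun s => hne _ (by rw [hj]; exact hU s)
    · exact fun s t hst => Finset.inf_mono hst
    · intro s
      simp only [Finset.inf_singleton]
    · intro s
      change j _ ∈ U1
      rw [hj]
      exact hU s
    · intro s
      have e1 : (s.inf fun i => b i ⊓ C {i}) = s.inf b ⊓ C s := by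
        rw [cm s]
        exact Finset.inf_inf
      have e2 : C s ≤ (s.inf b)ᶜ ⊔ A0 s :=
        (cr s).trans (Finset.inf_le (Finset.mem_powerset_self s))
      change (s.inf fun i => b i ⊓ C {i}) ≤ A0 s
      rw [e1]
      refine (inf_le_inf_left _ e2).trans ?_
      rw [inf_sup_left, inf_compl_eq_bot, bot_sup_eq]
      exact inf_le_right
end
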